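/- Let n ≥ 3 and let C_n be the cycle graph on n vertices. Then C_n is sequentially S_2 over a field k if and only if n is odd. -/

import Mathlib

open MvPolynomial

namespace SeqSr

/-! ### Abstract simplicial complexes -/

/-- An abstract simplicial complex on the vertex set `V`, viewed as a set of finite
subsets of `V` (its faces) closed under taking subsets. -/
def IsComplex {V : Type*} (Δ : Set (Finset V)) : Prop :=
  ∀ F ∈ Δ, ∀ G : Finset V, G ⊆ F → G ∈ Δ

/-- `Δ` is `(d-1)`-dimensional: every face has at most `d` vertices and
some face has exactly `d` vertices. -/
def HasDim {V : Type*} (Δ : Set (Finset V)) (d : ℕ) : Prop :=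
  (∀ F ∈ Δ, F.card ≤ d) ∧ ∃ F ∈ Δ, F.card = d

/-- A facet is a maximal face. -/
def IsFacet {V : Type*} (Δ : Set (Finset V)) (F : Finset V) : Prop :=
  F ∈ Δ ∧ ∀ G ∈ Δ, F ⊆ G → F = G

/-- A simplicial complex is pure if all facets have the same number of vertices. -/
def IsPure {V : Type*} (Δ : Set (Finset V)) : Prop :=
  ∀ F G : Finset V, IsFacet Δ F → IsFacet Δ G → F.card = G.card

/-- The link of a face `F` of `Δ`:
`lk_Δ F = {G : F ∩ G = ∅ and F ∪ G ∈ Δ}`. -/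
def link {V : Type*} [DecidableEq V] (Δ : Set (Finset V)) (F : Finset V) :
    Set (Finset V) :=
  {G | F ∩ G = ∅ ∧ F ∪ G ∈ Δ}

/-- The `i`-skeleton of `Δ`: all faces of dimension at most `i`
(i.e. with at most `i + 1` vertices). -/
def skeleton {V : Type*} (Δ : Set (Finset V)) (i : ℕ) : Set (Finset V) :=
  {F ∈ Δ | F.card ≤ i + 1}

/-- The pure `i`-skeleton of `Δ`: the subcomplex generated by the `i`-dimensional
faces of `Δ` (here `i : ℤ`, so that `i = -1` makes sense). -/
def pureSkeleton {V : Type*} (Δ : Set (Finset V)) (i : ℤ) : Set (Finset V) :=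
  {F | ∃ G ∈ Δ, (G.card : ℤ) = i + 1 ∧ F ⊆ G}

/-- A simplicial complex is connected if any two of its vertices can be joined by a
path of `1`-dimensional faces. -/
def IsConnectedComplex {V : Type*} [DecidableEq V] (Δ : Set (Finset V)) : Prop :=
  ∀ x y : V, {x} ∈ Δ → {y} ∈ Δ →
    Relation.ReflTransGen (fun a b : V => ({a, b} : Finset V) ∈ Δ) x y

/-! ### Stanley-Reisner rings -/

/-- The Stanley-Reisner ideal of `Δ` in the polynomial ring `k[x_v : v ∈ V]`:
the ideal generated by the squarefree monomials corresponding to non-faces of `Δ`. -/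
noncomputable def srIdeal (k : Type*) [Field k] {V : Type*} (Δ : Set (Finset V)) :
    Ideal (MvPolynomial V k) :=
  Ideal.span {m | ∃ F : Finset V, F ∉ Δ ∧ m = ∏ i ∈ F, X i}

/-! ### Depth, dimension and Serre's condition for modules -/

/-- The depth of `M` with respect to the ideal `I`: the supremum of the lengths of
`M`-regular sequences consisting of elements of `I`.  (For a finitely generated
module over a Noetherian local ring, taking `I` to be the maximal ideal recovers the
usual depth.) -/
noncomputable def depthIn (A : Type*) [CommRing A] (I : Ideal A) (M : Type*)
    [AddCommGroup M] [Module A M] : ℕ∞ :=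
  sSup {n : ℕ∞ | ∃ rs : List A, (∀ x ∈ rs, x ∈ I) ∧
    RingTheory.Sequence.IsRegular M rs ∧ (rs.length : ℕ∞) = n}

/-- The (Krull) dimension of a module `M` over `A`: the Krull dimension of the ring
`A` modulo the annihilator of `M`. -/
noncomputable def mDim (A : Type*) [CommRing A] (M : Type*)
    [AddCommGroup M] [Module A M] : WithBot ℕ∞ :=
  ringKrullDim (A ⧸ Module.annihilator A M)

/-- Serre's condition `S_r` for a module `M` over `A`: for every prime ideal `p`,
`depth M_p ≥ min (r, dim M_p)`. -/
def IsSerreMod (r : ℕ) (A : Type*) [CommRing A] (M : Type*)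
    [AddCommGroup M] [Module A M] : Prop :=
  ∀ (p : Ideal A) [p.IsPrime],
    min ((r : ℕ∞) : WithBot ℕ∞)
        (mDim (Localization p.primeCompl) (LocalizedModule p.primeCompl M)) ≤
      ((depthIn (Localization p.primeCompl)
          (Ideal.map (algebraMap A (Localization p.primeCompl)) p)
          (LocalizedModule p.primeCompl M) : ℕ∞) : WithBot ℕ∞)

/-- A module `M` over `A` is Cohen-Macaulay if `depth M_p ≥ dim M_p` for every
prime ideal `p` (the reverse inequality being automatic). -/
def IsCMMod (A : Type*) [CommRing A] (M : Type*) [AddCommGroup M] [Module A M] : Prop :=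
  ∀ (p : Ideal A) [p.IsPrime],
    mDim (Localization p.primeCompl) (LocalizedModule p.primeCompl M) ≤
      ((depthIn (Localization p.primeCompl)
          (Ideal.map (algebraMap A (Localization p.primeCompl)) p)
          (LocalizedModule p.primeCompl M) : ℕ∞) : WithBot ℕ∞)

/-- `Δ` satisfies Serre's condition `S_r` over `k` if its Stanley-Reisner ring
`k[Δ]` does, as a module over the polynomial ring. -/
def IsSerreComplex (k : Type*) [Field k] {V : Type*} (Δ : Set (Finset V)) (r : ℕ) :
    Prop :=
  IsSerreMod r (MvPolynomial V k) (MvPolynomial V k ⧸ srIdeal k Δ)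

/-! ### Sequentially `S_r` and sequentially Cohen-Macaulay complexes -/

/-- A homogeneous ideal of the polynomial ring (with respect to the standard
grading): an ideal containing all homogeneous components of its elements. -/
def IsHomogeneousIdeal (k : Type*) [Field k] {V : Type*}
    (J : Ideal (MvPolynomial V k)) : Prop :=
  ∀ f ∈ J, ∀ i : ℕ, homogeneousComponent i f ∈ J

/-- For ideals `J ⊆ J'` of `A`, the subquotient `J'/J` as an `A`-module. -/
abbrev subquot {A : Type*} [CommRing A] (J J' : Ideal A) : Type _ :=
  ↥J' ⧸ Submodule.comap J'.subtype J

/-- `Δ` is sequentially `S_r` over `k`: there is a finite filtration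
`0 = M_0 ⊂ M_1 ⊂ ⋯ ⊂ M_t = k[Δ]` of `k[Δ]` by graded submodules such that each
quotient `M_i/M_{i-1}` satisfies Serre's condition `S_r` and the (Krull) dimensions
of the quotients are strictly increasing.  Since `k[Δ]` is a cyclic module generated
in degree `0`, its graded submodules are exactly the images of homogeneous ideals
`J ⊇ I_Δ`, and `M_i/M_{i-1} = J_i/J_{i-1}`; we state the definition this way. -/
def IsSeqSerre (k : Type*) [Field k] {V : Type*} (Δ : Set (Finset V)) (r : ℕ) : Prop :=
  ∃ (t : ℕ) (J : ℕ → Ideal (MvPolynomial V k)),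
    J 0 = srIdeal k Δ ∧ J t = ⊤ ∧
    (∀ i ≤ t, IsHomogeneousIdeal k (J i)) ∧
    (∀ i < t, J i < J (i + 1)) ∧
    (∀ i < t, IsSerreMod r (MvPolynomial V k) (subquot (J i) (J (i + 1)))) ∧
    (∀ i : ℕ, i + 2 ≤ t →
      mDim (MvPolynomial V k) (subquot (J i) (J (i + 1))) <
        mDim (MvPolynomial V k) (subquot (J (i + 1)) (J (i + 2))))

/-- `Δ` is sequentially Cohen-Macaulay over `k`: there is a finite filtration
`0 = M_0 ⊂ M_1 ⊂ ⋯ ⊂ M_t = k[Δ]` by graded submodules with Cohen-Macaulay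
quotients of strictly increasing dimensions. -/
def IsSeqCM (k : Type*) [Field k] {V : Type*} (Δ : Set (Finset V)) : Prop :=
  ∃ (t : ℕ) (J : ℕ → Ideal (MvPolynomial V k)),
    J 0 = srIdeal k Δ ∧ J t = ⊤ ∧
    (∀ i ≤ t, IsHomogeneousIdeal k (J i)) ∧
    (∀ i < t, J i < J (i + 1)) ∧
    (∀ i < t, IsCMMod (MvPolynomial V k) (subquot (J i) (J (i + 1)))) ∧
    (∀ i : ℕ, i + 2 ≤ t →
      mDim (MvPolynomial V k) (subquot (J i) (J (i + 1))) <
        mDim (MvPolynomial V k) (subquot (J (i + 1)) (J (i + 2))))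

/-! ### Graphs -/

/-- The independence complex of a graph `G`: faces are the independent sets. -/
def indepComplex {V : Type*} (G : SimpleGraph V) : Set (Finset V) :=
  {F | ∀ x ∈ F, ∀ y ∈ F, ¬ G.Adj x y}

section Monomial

variable {k : Type*} [Field k] {V : Type*}

/-- A product of distinct variables is a monomial with exponent the indicator of the set. -/
lemma prod_X_eq_monomial (F : Finset V) :
    (∏ i ∈ F, X i : MvPolynomial V k) = monomial (∑ i ∈ F, Finsupp.single i 1) 1 := by
  rw [monomial_sum_one]
  rfl

lemma sum_single_le_iff (F : Finset V) (a : V →₀ ℕ) :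
    ∑ i ∈ F, Finsupp.single i 1 ≤ a ↔ F ⊆ a.support := by
  classical
  have key : ∀ j, (∑ i ∈ F, Finsupp.single i 1 : V →₀ ℕ) j = if j ∈ F then 1 else 0 := by
    intro j
    rw [Finsupp.finsetSum_apply]
    simp [Finsupp.single_apply]
  constructor
  · intro h j hj
    have := h j
    rw [key, if_pos hj] at this
    simp only [Finsupp.mem_support_iff]
    omega
  · intro h j
    rw [key]
    split_ifs with hj
    · have := h hj
      simp only [Finsupp.mem_support_iff] at this
      omega
    · exact Nat.zero_le _

/-- A polynomial lies in the Stanley-Reisner ideal iff no face supports one of its monomials. -/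
lemma mem_srIdeal_iff {Δ : Set (Finset V)} (hΔ : IsComplex Δ) {f : MvPolynomial V k} :
    f ∈ srIdeal k Δ ↔ ∀ a : V →₀ ℕ, a.support ∈ Δ → coeff a f = 0 := by
  have hspan : srIdeal k Δ = Ideal.span ((fun s => monomial s (1 : k)) ''
      {s | ∃ F : Finset V, F ∉ Δ ∧ s = ∑ i ∈ F, Finsupp.single i 1}) := by
    unfold srIdeal
    congr 1
    ext m
    constructor
    · rintro ⟨F, hF, rfl⟩
      exact ⟨_, ⟨F, hF, rfl⟩, (prod_X_eq_monomial F).symm⟩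
    · rintro ⟨_, ⟨F, hF, rfl⟩, rfl⟩
      exact ⟨F, hF, (prod_X_eq_monomial F).symm⟩
  rw [hspan, mem_ideal_span_monomial_image]
  constructor
  · intro h a ha
    by_contra hne
    obtain ⟨_, ⟨F, hF, rfl⟩, hle⟩ := h a (mem_support_iff.mpr hne)
    exact hF (hΔ _ ha _ ((sum_single_le_iff F a).mp hle))
  · intro h a ha
    refine ⟨_, ⟨a.support, fun hmem => mem_support_iff.mp ha (h a hmem), rfl⟩, ?_⟩
    exact (sum_single_le_iff _ a).mpr subset_rfl

lemma isHomogeneousIdeal_srIdeal {Δ : Set (Finset V)} (hΔ : IsComplex Δ) :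
    IsHomogeneousIdeal k (srIdeal k Δ) := by
  intro f hf i
  rw [mem_srIdeal_iff hΔ] at hf ⊢
  intro a ha
  classical
  rw [coeff_homogeneousComponent, hf a ha, ite_self]

/-- The ideal generated by the variables outside `F`. -/
noncomputable def facePrime (k : Type*) [Field k] {V : Type*} (F : Finset V) :
    Ideal (MvPolynomial V k) :=
  srIdeal k {G | G ⊆ F}

lemma mem_facePrime_iff {F : Finset V} {f : MvPolynomial V k} :
    f ∈ facePrime k F ↔ ∀ a : V →₀ ℕ, a.support ⊆ F → coeff a f = 0 :=
  mem_srIdeal_iff fun _ hF _ hG => hG.trans hF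

lemma facePrime_anti {F G : Finset V} (h : F ⊆ G) : facePrime k G ≤ facePrime k F := by
  intro f hf
  rw [mem_facePrime_iff] at hf ⊢
  exact fun a ha => hf a (ha.trans h)

lemma X_mem_facePrime_iff {F : Finset V} {v : V} :
    (X v : MvPolynomial V k) ∈ facePrime k F ↔ v ∉ F := by
  classical
  rw [mem_facePrime_iff]
  constructor
  · intro h hv
    have := h (Finsupp.single v 1) (by
      rw [Finsupp.support_single _ one_ne_zero]; simpa using hv)
    simp at this
  · intro hv a ha
    rw [coeff_X]
    split_ifs with h
    · subst h
      rw [Finsupp.support_single _ one_ne_zero] at ha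
      exact absurd (ha (Finset.mem_singleton_self v)) hv
    · rfl

lemma facePrime_eq_span (F : Finset V) :
    facePrime k F = Ideal.span (X '' {v | v ∉ F}) := by
  ext f
  rw [mem_facePrime_iff, mem_ideal_span_X_image]
  constructor
  · intro h a ha
    by_contra! hcon
    refine mem_support_iff.mp ha (h a fun v hv => ?_)
    by_contra hvF
    exact Finsupp.mem_support_iff.mp hv (hcon v hvF)
  · intro h a ha
    by_contra hne
    obtain ⟨v, hv, hav⟩ := h a (mem_support_iff.mpr hne)
    exact hv (ha (Finsupp.mem_support_iff.mpr hav))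

/-- Setting the variables outside `F` to zero. -/
noncomputable def restrictVars (k : Type*) [Field k] {V : Type*} (F : Finset V) :
    MvPolynomial V k →ₐ[k] MvPolynomial F k :=
  killCompl (Subtype.val_injective : Function.Injective ((↑) : F → V))

lemma restrictVars_surjective (F : Finset V) :
    Function.Surjective (restrictVars k F) := fun p =>
  ⟨rename ((↑) : F → V) p, killCompl_rename_app Subtype.val_injective p⟩

lemma restrictVars_X_of_notMem {F : Finset V} {v : V} (hv : v ∉ F) :
    restrictVars k F (X v) = 0 := by
  rw [restrictVars, killCompl, aeval_X, dif_neg]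
  rintro ⟨⟨w, hw⟩, rfl⟩
  exact hv hw

lemma restrictVars_X_of_mem {F : Finset V} {v : V} (hv : v ∈ F) :
    restrictVars k F (X v) = X ⟨v, hv⟩ := by
  have : (X v : MvPolynomial V k) = rename (↑) (X (⟨v, hv⟩ : F)) := by rw [rename_X]
  rw [this, restrictVars, killCompl_rename_app]

lemma ker_restrictVars (F : Finset V) :
    RingHom.ker (restrictVars k F).toRingHom = facePrime k F := by
  have hle : facePrime k F ≤ RingHom.ker (restrictVars k F).toRingHom := by
    rw [facePrime_eq_span, Ideal.span_le]
    rintro _ ⟨v, hv, rfl⟩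
    exact restrictVars_X_of_notMem hv
  refine le_antisymm (fun f hf => ?_) hle
  have hsub : f - rename (↑) (restrictVars k F f) ∈ facePrime k F := by
    have : ∀ g : MvPolynomial V k,
        Ideal.Quotient.mk (facePrime k F) g =
          Ideal.Quotient.mk (facePrime k F) (rename (↑) (restrictVars k F g)) := by
      intro g
      induction g using MvPolynomial.induction_on with
      | C a => simp [restrictVars]
      | add p q hp hq => simp only [map_add, hp, hq]
      | mul_X p v hp =>
        rw [map_mul, hp]
        simp only [map_mul]
        congr 1
        by_cases hv : v ∈ F
        · rw [restrictVars_X_of_mem hv, rename_X]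
        · rw [restrictVars_X_of_notMem hv, map_zero, map_zero]
          exact Ideal.Quotient.eq_zero_iff_mem.mpr (X_mem_facePrime_iff.mpr hv)
    exact Ideal.Quotient.eq.mp (this f)
  have h0 : restrictVars k F f = 0 := hf
  rwa [h0, map_zero, sub_zero] at hsub

instance facePrime_isPrime (F : Finset V) : (facePrime k F).IsPrime := by
  rw [← ker_restrictVars]
  exact RingHom.ker_isPrime _

lemma restrictVars_eq_zero_iff {F : Finset V} {f : MvPolynomial V k} :
    restrictVars k F f = 0 ↔ f ∈ facePrime k F := by
  rw [← ker_restrictVars]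
  rfl

lemma ringKrullDim_mvPolynomial [Finite V] :
    ringKrullDim (MvPolynomial V k) = (Nat.card V : ℕ) := by
  rw [MvPolynomial.ringKrullDim_of_isNoetherianRing, ringKrullDim_eq_zero_of_field, zero_add]

lemma facePrime_lt_of_ssubset {F G : Finset V} (h : F ⊂ G) :
    facePrime k G < facePrime k F := by
  refine lt_of_le_of_ne (facePrime_anti h.1) fun heq => ?_
  obtain ⟨v, hvG, hvF⟩ := Finset.exists_of_ssubset h
  exact X_mem_facePrime_iff.mp (heq ▸ X_mem_facePrime_iff.mpr hvF) hvG

lemma card_sub_le_height_facePrime [Fintype V] (F : Finset V) :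
    ((Fintype.card V - F.card : ℕ) : ℕ∞) ≤ (facePrime k F).height := by
  classical
  obtain ⟨j, hj⟩ : ∃ j, j = Fintype.card V - F.card := ⟨_, rfl⟩
  rw [← hj]
  induction j generalizing F with
  | zero => simp
  | succ j ih =>
    obtain ⟨v, hv⟩ : ∃ v, v ∉ F := by
      by_contra! hall
      rw [Finset.eq_univ_of_forall hall, Finset.card_univ] at hj
      omega
    have h1 := ih (insert v F) (by rw [Finset.card_insert_of_notMem hv]; omega)
    have h2 := Ideal.height_add_one_le_of_lt_of_isPrime
      (facePrime_lt_of_ssubset (k := k) (Finset.ssubset_insert hv))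
    push_cast
    exact (add_le_add_left h1 1).trans h2

/-- Chains of primes ending in `q` and starting above a face prime bound the height of `q`. -/
lemma add_length_le_height [Fintype V] {F : Finset V}
    {q : Ideal (MvPolynomial V k)}
    (c : LTSeries (PrimeSpectrum (MvPolynomial V k))) (hhead : facePrime k F ≤ c.head.asIdeal)
    (hlast : c.last.asIdeal ≤ q) :
    ((Fintype.card V - F.card + c.length : ℕ) : ℕ∞) ≤ q.height := by
  have h1 : (facePrime k F).height + (c.length : ℕ∞) ≤ c.last.asIdeal.height := by
    clear hlast
    induction c using RelSeries.inductionOn' with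
    | singleton x => simpa using Ideal.height_mono hhead
    | snoc c x hx ih =>
      have h1 := ih (by simpa using hhead)
      have h2 := Ideal.height_add_one_le_of_lt_of_isPrime
        (show c.last.asIdeal < x.asIdeal from hx)
      simp only [RelSeries.snoc_length, RelSeries.last_snoc]
      push_cast
      rw [← add_assoc]
      exact (add_le_add_left h1 1).trans h2
  push_cast
  exact (add_le_add_left (card_sub_le_height_facePrime F) _).trans
    (h1.trans (Ideal.height_mono hlast))

end Monomial

section Facets

variable {V : Type*}

/-- The subcomplex generated by the faces with more than `e` vertices. -/
def above (Δ : Set (Finset V)) (e : ℕ) : Set (Finset V) :=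
  {S | ∃ T ∈ Δ, S ⊆ T ∧ e < T.card}

/-- The facets with exactly `d` vertices, described as the faces of size `d` that are not
contained in a larger face. -/
def facetsOfCard (Δ : Set (Finset V)) (d : ℕ) : Set (Finset V) :=
  {F | F ∈ Δ ∧ F.card = d ∧ F ∉ above Δ d}

lemma isComplex_above (Δ : Set (Finset V)) (e : ℕ) : IsComplex (above Δ e) :=
  fun _ ⟨T, hT, hFT, hc⟩ _ hG => ⟨T, hT, hG.trans hFT, hc⟩

lemma above_anti (Δ : Set (Finset V)) {e e' : ℕ} (h : e ≤ e') : above Δ e' ⊆ above Δ e :=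
  fun _ ⟨T, hT, hFT, hc⟩ => ⟨T, hT, hFT, h.trans_lt hc⟩

/-- A family of scalars indexed by the facets of size `d` that contain `S` is compatible along
ridges if it is constant across every ridge containing `S` and vanishes on facets having such a
ridge in a larger face. -/
structure RidgeCompatible {K : Type*} [Zero K] (Δ : Set (Finset V)) (d : ℕ) (S : Finset V)
    (c : Finset V → K) : Prop where
  eq_of_ridge : ∀ F ∈ facetsOfCard Δ d, ∀ F' ∈ facetsOfCard Δ d, ∀ G : Finset V,
    G ⊆ F → G ⊆ F' → S ⊆ G → G.card + 1 = d → c F = c F'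
  eq_zero_of_ridge : ∀ F ∈ facetsOfCard Δ d, ∀ G ∈ above Δ d,
    G ⊆ F → S ⊆ G → G.card + 1 = d → c F = 0

/-- Ridge-compatible families come from a single scalar on each face. -/
def Glues (K : Type*) [Zero K] (Δ : Set (Finset V)) (d : ℕ) : Prop :=
  ∀ (S : Finset V) (c : Finset V → K), RidgeCompatible Δ d S c →
    (S ∉ above Δ d → ∀ F ∈ facetsOfCard Δ d, ∀ F' ∈ facetsOfCard Δ d,
      S ⊆ F → S ⊆ F' → c F = c F') ∧
    (S ∈ above Δ d → ∀ F ∈ facetsOfCard Δ d, S ⊆ F → c F = 0)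

lemma RidgeCompatible.mono {K : Type*} [Zero K] {Δ : Set (Finset V)} {d : ℕ} {S S' : Finset V}
    {c : Finset V → K} (h : RidgeCompatible Δ d S c) (hS : S ⊆ S') :
    RidgeCompatible Δ d S' c where
  eq_of_ridge F hF F' hF' G h1 h2 h3 h4 := h.eq_of_ridge F hF F' hF' G h1 h2 (hS.trans h3) h4
  eq_zero_of_ridge F hF G hG h1 h3 h4 := h.eq_zero_of_ridge F hF G hG h1 (hS.trans h3) h4

end Facets

section Cycle

variable {n : ℕ} [NeZero n]

lemma fin_val_sub_one {x : Fin n} (hx : x ≠ 0) : (x - 1).val + 1 = x.val := by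
  obtain ⟨m, rfl⟩ : ∃ m, n = m + 1 := ⟨n - 1, by have := NeZero.pos n; omega⟩
  rw [Fin.val_sub_one_of_ne_zero hx]
  have : x.val ≠ 0 := fun h => hx (Fin.ext h)
  omega

/-- Induction around the cycle. -/
lemma cyclic_induction {P : Fin n → Prop} (s : Fin n) (h0 : P s) (h1 : ∀ v, P v → P (v + 1))
    (v : Fin n) : P v := by
  have key : ∀ (j : ℕ) (w : Fin n), w.val = j → P (s + w) := by
    intro j
    induction j with
    | zero =>
      intro w hw
      have : w = 0 := Fin.ext hw
      rwa [this, add_zero]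
    | succ j ih =>
      intro w hw
      have hw0 : w ≠ 0 := by
        rintro rfl
        simp at hw
      have := h1 _ (ih (w - 1) (by have := fin_val_sub_one hw0; omega))
      rwa [add_assoc, sub_add_cancel] at this
  have := key _ (v - s) rfl
  rwa [add_sub_cancel] at this

/-- The independence complex of the cycle graph. -/
abbrev cycleComplex (n : ℕ) : Set (Finset (Fin n)) := indepComplex (SimpleGraph.cycleGraph n)

lemma fin_one_ne_zero (hn : 2 ≤ n) : (1 : Fin n) ≠ 0 := by
  obtain ⟨m, rfl⟩ : ∃ m, n = m + 2 := ⟨n - 2, by omega⟩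
  simp

lemma mem_cycleComplex (hn : 2 ≤ n) {F : Finset (Fin n)} :
    F ∈ cycleComplex n ↔ ∀ x ∈ F, x + 1 ∉ F := by
  obtain ⟨m, rfl⟩ : ∃ m, n = m + 2 := ⟨n - 2, by omega⟩
  constructor
  · intro h x hx hx1
    refine h x hx _ hx1 ?_
    rw [SimpleGraph.cycleGraph_adj]
    right
    abel
  · intro h x hx y hy hadj
    rw [SimpleGraph.cycleGraph_adj] at hadj
    rcases hadj with h1 | h1
    · exact h y hy (by rwa [← h1, add_sub_cancel])
    · exact h x hx (by rwa [← h1, add_sub_cancel])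

omit [NeZero n] in
lemma cycleComplex_isComplex : IsComplex (cycleComplex n) :=
  fun _ hF _ hG x hx y hy => hF x (hG hx) y (hG hy)

lemma two_mul_card_le (hn : 2 ≤ n) {F : Finset (Fin n)} (hF : F ∈ cycleComplex n) :
    2 * F.card ≤ n := by
  rw [mem_cycleComplex hn] at hF
  have hd : Disjoint F (F.map (Equiv.addRight (1 : Fin n)).toEmbedding) := by
    rw [Finset.disjoint_left]
    intro x hx hx'
    obtain ⟨y, hy, rfl⟩ := Finset.mem_map.mp hx'
    exact hF y hy hx
  have := Finset.card_le_univ (F ∪ F.map (Equiv.addRight (1 : Fin n)).toEmbedding)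
  rw [Finset.card_union_of_disjoint hd, Finset.card_map, Fintype.card_fin] at this
  omega

/-- Rotations of the cycle preserve independence. -/
lemma map_addRight_mem (hn : 2 ≤ n) {F : Finset (Fin n)} (hF : F ∈ cycleComplex n) (s : Fin n) :
    F.map (Equiv.addRight s).toEmbedding ∈ cycleComplex n := by
  rw [mem_cycleComplex hn] at hF ⊢
  intro x hx hx'
  obtain ⟨y, hy, rfl⟩ := Finset.mem_map.mp hx
  obtain ⟨z, hz, hzy⟩ := Finset.mem_map.mp hx'
  simp only [Equiv.coe_toEmbedding, Equiv.coe_addRight] at hzy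
  have : z = y + 1 := add_right_cancel (hzy.trans (by abel))
  exact hF y hy (this ▸ hz)

lemma mem_or_neighbor_mem (hn : 2 ≤ n) {d : ℕ} {F : Finset (Fin n)}
    (hF : F ∈ facetsOfCard (cycleComplex n) d) {v : Fin n} (hv : v ∉ F) :
    v - 1 ∈ F ∨ v + 1 ∈ F := by
  by_contra! hcon
  refine hF.2.2 ⟨insert v F, ?_, Finset.subset_insert _ _, ?_⟩
  · have hF1 := (mem_cycleComplex hn).mp hF.1
    rw [mem_cycleComplex hn]
    intro x hx
    rw [Finset.mem_insert] at hx ⊢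
    rcases hx with rfl | hx
    · rintro (h | h)
      · exact fin_one_ne_zero hn (by simpa using h)
      · exact hcon.2 h
    · rintro (h | h)
      · exact hcon.1 (by rwa [← h, add_sub_cancel_right])
      · exact hF1 x hx h
  · rw [Finset.card_insert_of_notMem hv, hF.2.1]
    exact Nat.lt_succ_self d

/-- A facet is packed relative to `S` if each of its vertices outside `S` is preceded by a vertex
at distance two. -/
def Packed (S F : Finset (Fin n)) : Prop := ∀ f ∈ F, f ∉ S → f - 1 - 1 ∈ F

lemma Packed.eq (hn : 2 ≤ n) {d : ℕ} {S F F' : Finset (Fin n)} {s : Fin n} (hs : s ∈ S)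
    (hF : F ∈ facetsOfCard (cycleComplex n) d) (hF' : F' ∈ facetsOfCard (cycleComplex n) d)
    (hSF : S ⊆ F) (hSF' : S ⊆ F') (hp : Packed S F) (hp' : Packed S F') : F = F' := by
  have step : ∀ F : Finset (Fin n), F ∈ facetsOfCard (cycleComplex n) d → S ⊆ F → Packed S F →
      ∀ v : Fin n, v + 1 + 1 ∈ F ↔ v + 1 + 1 ∈ S ∨ (v ∈ F ∧ v + 1 + 1 + 1 ∉ S) := by
    intro F hF hSF hp v
    have hF1 := (mem_cycleComplex hn).mp hF.1
    constructor
    · intro h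
      by_cases hS : v + 1 + 1 ∈ S
      · exact Or.inl hS
      · have := hp _ h hS
        simp only [add_sub_cancel_right] at this
        exact Or.inr ⟨this, fun h' => hF1 _ h (hSF h')⟩
    · rintro (h | ⟨h1, h2⟩)
      · exact hSF h
      · by_contra hv
        rcases mem_or_neighbor_mem hn hF hv with h | h
        · rw [add_sub_cancel_right] at h
          exact hF1 _ h1 h
        · have := hp _ h h2
          simp only [add_sub_cancel_right] at this
          exact hF1 _ h1 this
  have hF1 := (mem_cycleComplex hn).mp hF.1
  have hF1' := (mem_cycleComplex hn).mp hF'.1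
  have key : ∀ v, (v ∈ F ↔ v ∈ F') ∧ (v + 1 ∈ F ↔ v + 1 ∈ F') := by
    refine cyclic_induction s ⟨?_, ?_⟩ ?_
    · simp [hSF hs, hSF' hs]
    · simp [hF1 s (hSF hs), hF1' s (hSF' hs)]
    · rintro v ⟨h1, h2⟩
      refine ⟨h2, ?_⟩
      rw [step F hF hSF hp, step F' hF' hSF' hp', h1]
  ext v
  exact (key v).1

lemma Packed.notMem_above (hn : 2 ≤ n) {d : ℕ} {S F : Finset (Fin n)}
    (hF : F ∈ facetsOfCard (cycleComplex n) d) (hp : Packed S F) :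
    S ∉ above (cycleComplex n) d := by
  rintro ⟨T, hT, hST, hd⟩
  rw [mem_cycleComplex hn] at hT
  have hmaps : ∀ v ∈ T, (if v ∈ F then v else v - 1) ∈ F := by
    intro v hv
    split_ifs with h
    · exact h
    · rcases mem_or_neighbor_mem hn hF h with h' | h'
      · exact h'
      · have := hp _ h' fun hS => hT v hv (hST hS)
        rwa [add_sub_cancel_right] at this
  have hinj : Set.InjOn (fun v => if v ∈ F then v else v - 1) (T : Set (Fin n)) := by
    intro v hv w hw hvw
    dsimp only at hvw
    split_ifs at hvw with h1 h2 h2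
    · exact hvw
    · exact absurd hw (by
        have := hT v hv
        rwa [hvw, sub_add_cancel] at this)
    · exact absurd hv (by
        have := hT w hw
        rwa [← hvw, sub_add_cancel] at this)
    · exact sub_left_injective hvw
  have := Finset.card_le_card_of_injOn _ hmaps hinj
  rw [hF.2.1] at this
  omega

/-- Moving a vertex of an independent set one step back. -/
lemma shift_mem (hn : 2 ≤ n) {F : Finset (Fin n)} (hF : F ∈ cycleComplex n) {f : Fin n}
    (hf2 : f - 1 - 1 ∉ F) : insert (f - 1) (F.erase f) ∈ cycleComplex n := by
  have h1 := fin_one_ne_zero hn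
  rw [mem_cycleComplex hn] at hF ⊢
  intro x hx
  rw [Finset.mem_insert, Finset.mem_erase] at hx ⊢
  rcases hx with rfl | ⟨hxf, hx⟩
  · rintro (h | h)
    · exact h1 (add_eq_left.mp h)
    · exact h.1 (sub_add_cancel _ _)
  · rintro (h | h)
    · exact hf2 (by rwa [← h, add_sub_cancel_right])
    · exact hF x hx h.2

lemma card_shift (hn : 2 ≤ n) {F : Finset (Fin n)} (hF : F ∈ cycleComplex n) {f : Fin n}
    (hf : f ∈ F) : (insert (f - 1) (F.erase f)).card = F.card := by
  rw [mem_cycleComplex hn] at hF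
  have : f - 1 ∉ F.erase f := fun h =>
    hF _ (Finset.mem_of_mem_erase h) (by rwa [sub_add_cancel])
  rw [Finset.card_insert_of_notMem this, Finset.card_erase_add_one hf]

/-- Every facet can be packed relative to a nonempty `S` without changing the scalar, unless the
scalar vanishes. -/
lemma RidgeCompatible.exists_packed (hn : 2 ≤ n) {K : Type*} [Zero K] {d : ℕ} {S : Finset (Fin n)}
    {c : Finset (Fin n) → K} (hc : RidgeCompatible (cycleComplex n) d S c) {s : Fin n}
    (hs : s ∈ S) {F : Finset (Fin n)} (hF : F ∈ facetsOfCard (cycleComplex n) d) (hSF : S ⊆ F) :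
    (S ∈ above (cycleComplex n) d ∧ c F = 0) ∨
      ∃ F' ∈ facetsOfCard (cycleComplex n) d, S ⊆ F' ∧ Packed S F' ∧ c F = c F' := by
  obtain ⟨j, hj⟩ : ∃ j, j = ∑ v ∈ F, (v - s).val := ⟨_, rfl⟩
  induction j using Nat.strong_induction_on generalizing F with
  | _ j ih =>
  by_cases hp : Packed S F
  · exact Or.inr ⟨F, hF, hSF, hp, rfl⟩
  simp only [Packed, not_forall] at hp
  obtain ⟨f, hf, hfS, hf2⟩ := hp
  have hSG : S ⊆ F.erase f := fun x hx =>
    Finset.mem_erase.mpr ⟨fun h => hfS (h ▸ hx), hSF hx⟩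
  have hGcard : (F.erase f).card + 1 = d := by rw [Finset.card_erase_add_one hf, hF.2.1]
  by_cases hG : F.erase f ∈ above (cycleComplex n) d
  · exact Or.inl ⟨isComplex_above _ _ _ hG _ hSG,
      hc.eq_zero_of_ridge F hF _ hG (Finset.erase_subset _ _) hSG hGcard⟩
  have hGF' : F.erase f ⊆ insert (f - 1) (F.erase f) := Finset.subset_insert _ _
  have hF' : insert (f - 1) (F.erase f) ∈ facetsOfCard (cycleComplex n) d :=
    ⟨shift_mem hn hF.1 hf2, (card_shift hn hF.1 hf).trans hF.2.1,
      fun h => hG (isComplex_above _ _ _ h _ hGF')⟩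
  have hcF : c F = c (insert (f - 1) (F.erase f)) :=
    hc.eq_of_ridge F hF _ hF' _ (Finset.erase_subset _ _) hGF' hSG hGcard
  rw [hcF]
  refine ih _ ?_ hF' (hSG.trans hGF') rfl
  have hnot : f - 1 ∉ F.erase f := fun h =>
    (mem_cycleComplex hn).mp hF.1 _ (Finset.mem_of_mem_erase h) (by rwa [sub_add_cancel])
  rw [hj, Finset.sum_insert hnot, ← Finset.add_sum_erase F _ hf]
  have hfs : f - s ≠ 0 := fun h => hfS (by rwa [sub_eq_zero.mp h])
  have := fin_val_sub_one hfs
  rw [show f - 1 - s = f - s - 1 by abel]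
  omega

lemma RidgeCompatible.eq_of_mem (hn : 2 ≤ n) {K : Type*} [Zero K] {d : ℕ} {S : Finset (Fin n)}
    {c : Finset (Fin n) → K} (hc : RidgeCompatible (cycleComplex n) d S c) {s : Fin n}
    (hs : s ∈ S) :
    (S ∉ above (cycleComplex n) d → ∀ F ∈ facetsOfCard (cycleComplex n) d,
      ∀ F' ∈ facetsOfCard (cycleComplex n) d, S ⊆ F → S ⊆ F' → c F = c F') ∧
    (S ∈ above (cycleComplex n) d → ∀ F ∈ facetsOfCard (cycleComplex n) d, S ⊆ F → c F = 0) := by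
  constructor
  · intro hS F hF F' hF' hSF hSF'
    rcases hc.exists_packed hn hs hF hSF with h | ⟨F₀, hF₀, hSF₀, hp, h⟩
    · exact absurd h.1 hS
    rcases hc.exists_packed hn hs hF' hSF' with h' | ⟨F₀', hF₀', hSF₀', hp', h'⟩
    · exact absurd h'.1 hS
    rw [h, h', hp.eq hn hs hF₀ hF₀' hSF₀ hSF₀' hp']
  · intro hS F hF hSF
    rcases hc.exists_packed hn hs hF hSF with h | ⟨F₀, hF₀, hSF₀, hp, h⟩
    · exact h.2
    · exact absurd hS (hp.notMem_above hn hF₀)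

/-- On an odd cycle, no nonempty independent set is stable under moving back two steps. -/
lemma exists_sub_two_notMem (hodd : Odd n) (hn : 2 ≤ n) {F : Finset (Fin n)}
    (hF : F ∈ cycleComplex n) (hne : F.Nonempty) : ∃ f ∈ F, f - 1 - 1 ∉ F := by
  by_contra! hcon
  obtain ⟨s, hs⟩ := hne
  have hiter : ∀ j : ℕ, s - (2 * j) • (1 : Fin n) ∈ F := by
    intro j
    induction j with
    | zero => simpa using hs
    | succ j ih =>
      have := hcon _ ih
      rwa [show s - (2 * j) • (1 : Fin n) - 1 - 1 = s - (2 * (j + 1)) • (1 : Fin n) by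
        rw [mul_add, add_smul, mul_one, two_smul]; abel] at this
  obtain ⟨m, hm⟩ := hodd
  have h1 := hiter m
  have hn0 : n • (1 : Fin n) = 0 := by
    simpa using card_nsmul_eq_zero (x := (1 : Fin n))
  have h2 : s - (2 * m) • (1 : Fin n) = s + 1 := by
    have hn1 : (2 * m) • (1 : Fin n) + 1 = 0 := by rw [← succ_nsmul, ← hm, hn0]
    rw [eq_neg_of_add_eq_zero_left hn1, sub_neg_eq_add]
  rw [h2] at h1
  exact (mem_cycleComplex hn).mp hF s hs h1

lemma rotate_mem_facetsOfCard (hn : 2 ≤ n) {d : ℕ} {F : Finset (Fin n)}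
    (hF : F ∈ facetsOfCard (cycleComplex n) d)
    (hd : (∅ : Finset (Fin n)) ∉ above (cycleComplex n) d) (s : Fin n) :
    F.map (Equiv.addRight s).toEmbedding ∈ facetsOfCard (cycleComplex n) d :=
  ⟨map_addRight_mem hn hF.1 s, by rw [Finset.card_map, hF.2.1],
    fun h => hd (isComplex_above _ _ _ h _ (Finset.empty_subset _))⟩

/-- Odd cycles have the gluing property in every dimension. -/
theorem glues_cycleComplex (hodd : Odd n) (hn : 2 ≤ n) (K : Type*) [Zero K] {d : ℕ} (hd : 0 < d) :
    Glues K (cycleComplex n) d := by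
  intro S c hc
  rcases S.eq_empty_or_nonempty with rfl | ⟨s, hs⟩
  swap
  · exact hc.eq_of_mem hn hs
  have hcs : ∀ s : Fin n, RidgeCompatible (cycleComplex n) d {s} c := fun s =>
    hc.mono (Finset.empty_subset _)
  have hne : ∀ F ∈ facetsOfCard (cycleComplex n) d, F.Nonempty := fun F hF =>
    Finset.card_pos.mp (by rw [hF.2.1]; exact hd)
  constructor
  · intro hS F hF F' hF' _ _
    have hsing : ∀ s : Fin n, {s} ∉ above (cycleComplex n) d := fun s h =>
      hS (isComplex_above _ _ _ h _ (Finset.empty_subset _))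
    have hall : ∀ G : Finset (Fin n), G ∈ cycleComplex n → G.card = d →
        G ∈ facetsOfCard (cycleComplex n) d := fun G h1 h2 =>
      ⟨h1, h2, fun h => hS (isComplex_above _ _ _ h _ (Finset.empty_subset _))⟩
    have hmem : ∀ s : Fin n, ∀ G ∈ facetsOfCard (cycleComplex n) d,
        ∀ G' ∈ facetsOfCard (cycleComplex n) d, s ∈ G → s ∈ G' → c G = c G' :=
      fun s G hG G' hG' h h' => ((hcs s).eq_of_mem hn (Finset.mem_singleton_self s)).1 (hsing s)
        G hG G' hG' (Finset.singleton_subset_iff.mpr h) (Finset.singleton_subset_iff.mpr h')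
    obtain ⟨f, hf, hf2⟩ := exists_sub_two_notMem hodd hn hF.1 (hne F hF)
    obtain ⟨s, hs⟩ := hne F hF
    have key : ∀ v : Fin n, ∀ G ∈ facetsOfCard (cycleComplex n) d, v ∈ G → c G = c F := by
      refine cyclic_induction s (fun G hG hsG => hmem s G hG F hF hsG hs) ?_
      intro v ih G hG hvG
      have hR := rotate_mem_facetsOfCard hn hF hS (v + 1 - f)
      set R := F.map (Equiv.addRight (v + 1 - f)).toEmbedding with hRdef
      have hvR : v + 1 ∈ R := Finset.mem_map.mpr ⟨f, hf, by simp⟩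
      have hvR2 : v + 1 - 1 - 1 ∉ R := by
        intro h
        obtain ⟨y, hy, hyv⟩ := Finset.mem_map.mp h
        simp only [Equiv.coe_toEmbedding, Equiv.coe_addRight] at hyv
        have : y = f - 1 - 1 := by
          rw [eq_sub_of_add_eq hyv]; abel
        exact hf2 (this ▸ hy)
      have hR' : insert (v + 1 - 1) (R.erase (v + 1)) ∈ facetsOfCard (cycleComplex n) d :=
        hall _ (shift_mem hn hR.1 hvR2) ((card_shift hn hR.1 hvR).trans hR.2.1)
      rw [hmem (v + 1) G hG R hR hvG hvR,
        hc.eq_of_ridge R hR _ hR' _ (Finset.erase_subset _ _) (Finset.subset_insert _ _)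
          (Finset.empty_subset _) (by rw [Finset.card_erase_add_one hvR, hR.2.1])]
      exact ih _ hR' (by rw [add_sub_cancel_right]; exact Finset.mem_insert_self _ _)
    obtain ⟨s', hs'⟩ := hne F' hF'
    exact (key s' F' hF' hs').symm
  · rintro ⟨T, hT, -, hTd⟩ F hF _
    obtain ⟨s, hs⟩ := hne F hF
    obtain ⟨t, ht⟩ := Finset.card_pos.mp ((Nat.zero_le d).trans_lt hTd)
    refine ((hcs s).eq_of_mem hn (Finset.mem_singleton_self s)).2 ?_ F hF
      (Finset.singleton_subset_iff.mpr hs)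
    refine ⟨_, map_addRight_mem hn hT (s - t), ?_, by rwa [Finset.card_map]⟩
    exact Finset.singleton_subset_iff.mpr (Finset.mem_map.mpr ⟨t, ht, by simp⟩)


/-- Every independent set of the cycle extends to one with at least a third of the vertices. -/
lemma above_cycleComplex_of_lt (hn : 2 ≤ n) {e : ℕ} (he : 3 * e < n) :
    above (cycleComplex n) e = cycleComplex n := by
  ext S
  refine ⟨fun ⟨T, hT, hST, _⟩ => cycleComplex_isComplex _ hT _ hST, fun hS => ?_⟩
  classical
  obtain ⟨T, hT, hmax⟩ := (Finset.univ.filter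
    (fun T : Finset (Fin n) => T ∈ cycleComplex n ∧ S ⊆ T)).exists_max_image Finset.card
    ⟨S, by simp [hS]⟩
  simp only [Finset.mem_filter, Finset.mem_univ, true_and] at hT hmax
  have hfacet : T ∈ facetsOfCard (cycleComplex n) T.card :=
    ⟨hT.1, rfl, fun ⟨U, hU, hTU, hlt⟩ => (hmax U ⟨hU, hT.2.trans hTU⟩).not_gt hlt⟩
  refine ⟨T, hT.1, hT.2, ?_⟩
  have hcover : (Finset.univ : Finset (Fin n)) ⊆ T ∪
      (T.map (Equiv.addRight (1 : Fin n)).toEmbedding ∪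
        T.map (Equiv.addRight (-1 : Fin n)).toEmbedding) := by
    intro v _
    by_cases hv : v ∈ T
    · exact Finset.mem_union_left _ hv
    refine Finset.mem_union_right _ ?_
    rcases mem_or_neighbor_mem hn hfacet hv with h | h
    · exact Finset.mem_union_left _ (Finset.mem_map.mpr ⟨_, h, by simp⟩)
    · exact Finset.mem_union_right _ (Finset.mem_map.mpr ⟨_, h, by simp⟩)
  have h1 := Finset.card_le_card hcover
  have h2 := Finset.card_union_le T (T.map (Equiv.addRight (1 : Fin n)).toEmbedding ∪
        T.map (Equiv.addRight (-1 : Fin n)).toEmbedding)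
  have h3 := Finset.card_union_le (T.map (Equiv.addRight (1 : Fin n)).toEmbedding)
        (T.map (Equiv.addRight (-1 : Fin n)).toEmbedding)
  rw [Finset.card_map, Finset.card_map] at h3
  rw [Finset.card_univ, Fintype.card_fin] at h1
  omega

lemma fin_val_add_one (hn : 2 ≤ n) (x : Fin n) :
    (x + 1).val = if x.val + 1 = n then 0 else x.val + 1 := by
  obtain ⟨m, rfl⟩ : ∃ m, n = m + 2 := ⟨n - 2, by omega⟩
  rw [Fin.val_add_one]
  simp only [Fin.ext_iff, Fin.val_last]
  split_ifs <;> omega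

/-- The cycle has facets of every size between `n / 3` and `n / 2`. -/
lemma exists_facetOfCard (hn : 3 ≤ n) {d : ℕ} (h3 : n ≤ 3 * d) (h2 : 2 * d ≤ n) :
    (facetsOfCard (cycleComplex n) d).Nonempty := by
  obtain ⟨b, hb⟩ : ∃ b, b + 2 * d = n := ⟨n - 2 * d, by omega⟩
  obtain ⟨a, ha⟩ : ∃ a, a + b = d := ⟨d - b, by omega⟩
  set F : Finset (Fin n) := Finset.univ.filter
    (fun v => v.val < 2 * a ∧ v.val % 2 = 0 ∨ 2 * a ≤ v.val ∧ (v.val - 2 * a) % 3 = 0) with hF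
  have hmem : ∀ v : Fin n, v ∈ F ↔
      (v.val < 2 * a ∧ v.val % 2 = 0 ∨ 2 * a ≤ v.val ∧ (v.val - 2 * a) % 3 = 0) := by
    simp [hF]
  have hind : F ∈ cycleComplex n := by
    rw [mem_cycleComplex (by omega)]
    intro x hx hx'
    rw [hmem] at hx hx'
    rw [fin_val_add_one (by omega)] at hx'
    have := x.isLt
    split_ifs at hx' <;> omega
  have hcard : F.card = d := by
    let g : Fin d → Fin n := fun j =>
      if h : j.val < a then ⟨2 * j.val, by omega⟩
      else ⟨2 * a + 3 * (j.val - a), by have := j.isLt; omega⟩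
    have hg : ∀ j : Fin d, (g j).val =
        if j.val < a then 2 * j.val else 2 * a + 3 * (j.val - a) := by
      intro j
      dsimp only [g]
      split_ifs <;> rfl
    have hinj : Function.Injective g := by
      intro i j hij
      have := congrArg Fin.val hij
      rw [hg, hg] at this
      ext
      split_ifs at this <;> omega
    have himage : F = Finset.univ.map ⟨g, hinj⟩ := by
      ext v
      simp only [hmem, Finset.mem_map, Finset.mem_univ, true_and, Function.Embedding.coeFn_mk]
      constructor
      · rintro (h | h)
        · refine ⟨⟨v.val / 2, by omega⟩, ?_⟩
          ext
          rw [hg]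
          dsimp only
          rw [if_pos (by omega)]
          omega
        · have := v.isLt
          refine ⟨⟨a + (v.val - 2 * a) / 3, by omega⟩, ?_⟩
          ext
          rw [hg]
          dsimp only
          rw [if_neg (by omega)]
          omega
      · rintro ⟨j, rfl⟩
        rw [hg]
        split_ifs <;> omega
    rw [himage, Finset.card_map, Finset.card_univ, Fintype.card_fin]
  refine ⟨F, hind, hcard, ?_⟩
  rintro ⟨T, hT, hFT, hlt⟩
  obtain ⟨v, hvT, hvF⟩ := Finset.exists_of_ssubset
    (Finset.ssubset_iff_subset_ne.mpr ⟨hFT, by rintro rfl; omega⟩)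
  rw [mem_cycleComplex (by omega)] at hT
  have h0 : (0 : Fin n).val = 0 := by simp
  by_cases hv : v + 1 ∈ F
  · exact hT v hvT (hFT hv)
  · have hv0 : v ≠ 0 := by
      rintro rfl
      rw [hmem] at hvF
      rw [h0] at hvF
      omega
    have hv1 : v - 1 ∈ F := by
      have hlt' := v.isLt
      rw [hmem, fin_val_add_one (by omega)] at hv
      rw [hmem] at hvF ⊢
      have := fin_val_sub_one hv0
      split_ifs at hv
      · omega
      · rcases lt_or_ge v.val (2 * a) with h | h
        · exact Or.inl ⟨by omega, by omega⟩
        · obtain ⟨r, hr⟩ : ∃ r, r + 2 * a = v.val := ⟨v.val - 2 * a, by omega⟩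
          have hr1 : (r + 1) % 3 ≠ 0 := fun h' => hv (Or.inr ⟨by omega, by omega⟩)
          have hr0 : r % 3 ≠ 0 := fun h' => hvF (Or.inr ⟨h, by omega⟩)
          exact Or.inr ⟨by omega, by omega⟩
    exact hT _ (hFT hv1) (by rwa [sub_add_cancel])

end Cycle

section Dimension

variable {k : Type*} [Field k] {V : Type*} [Fintype V]

lemma add_length_le_height_of_card_le {d : ℕ} {K q : Ideal (MvPolynomial V k)} [q.IsPrime]
    (hK : ∀ p : Ideal (MvPolynomial V k), p.IsPrime → K ≤ p →
      ∃ F : Finset V, F.card ≤ d ∧ facePrime k F ≤ p)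
    (c : LTSeries (PrimeSpectrum (MvPolynomial V k))) (hhead : K ≤ c.head.asIdeal)
    (hlast : c.last.asIdeal ≤ q) :
    ((Fintype.card V - d + c.length : ℕ) : ℕ∞) ≤ q.height := by
  obtain ⟨F, hFd, hF⟩ := hK _ c.head.isPrime hhead
  refine le_trans ?_ (add_length_le_height c hF hlast)
  exact_mod_cast Nat.add_le_add_right (Nat.sub_le_sub_left hFd _) _

lemma height_le_card (q : Ideal (MvPolynomial V k)) [q.IsPrime] :
    q.height ≤ (Fintype.card V : ℕ∞) := by
  have h := Ideal.height_le_ringKrullDim_of_isPrime (I := q)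
  rw [ringKrullDim_mvPolynomial, Nat.card_eq_fintype_card] at h
  exact_mod_cast h

lemma ringKrullDim_quotient_le {d : ℕ} {K : Ideal (MvPolynomial V k)}
    (hK : ∀ p : Ideal (MvPolynomial V k), p.IsPrime → K ≤ p →
      ∃ F : Finset V, F.card ≤ d ∧ facePrime k F ≤ p) :
    ringKrullDim (MvPolynomial V k ⧸ K) ≤ d := by
  refine iSup_le fun c => ?_
  have hmono : StrictMono (PrimeSpectrum.comap (Ideal.Quotient.mk K)) :=
    Monotone.strictMono_of_injective (fun p q h => Ideal.comap_mono h)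
      (PrimeSpectrum.comap_injective_of_surjective _ Ideal.Quotient.mk_surjective)
  obtain ⟨F, hFd, hF⟩ := hK _ (c.map _ hmono).head.isPrime (by
    intro f hf
    change Ideal.Quotient.mk K f ∈ c.head.asIdeal
    rw [Ideal.Quotient.eq_zero_iff_mem.mpr hf]
    exact zero_mem _)
  have h := (add_length_le_height (c.map _ hmono) hF le_rfl).trans (height_le_card _)
  have hlen : (c.map _ hmono).length = c.length := rfl
  rw [hlen] at h
  have h1 : Fintype.card V - F.card + c.length ≤ Fintype.card V := by exact_mod_cast h
  have h2 := F.card_le_univ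
  exact_mod_cast (by omega : c.length ≤ d)

lemma card_le_mDim {M : Type*} [AddCommGroup M] [Module (MvPolynomial V k) M] {F : Finset V}
    (h : Module.annihilator (MvPolynomial V k) M ≤ facePrime k F) :
    (F.card : WithBot ℕ∞) ≤ mDim (MvPolynomial V k) M := by
  have hker : ∀ a ∈ Module.annihilator (MvPolynomial V k) M,
      (restrictVars k F).toRingHom a = 0 := fun a ha => restrictVars_eq_zero_iff.mpr (h ha)
  have h1 := ringKrullDim_le_of_surjective (Ideal.Quotient.lift _ _ hker)
    (Ideal.Quotient.lift_surjective_of_surjective _ hker (restrictVars_surjective F))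
  rw [ringKrullDim_mvPolynomial, Nat.card_eq_fintype_card, Fintype.card_coe] at h1
  exact h1

end Dimension

section Localization

variable {R : Type*} [CommRing R]

lemma exists_ltSeries_of_le_mDim {q : Ideal R} [q.IsPrime] {M : Type*} [AddCommGroup M]
    [Module R M] {j : ℕ}
    (h : (j : WithBot ℕ∞) ≤ mDim (Localization q.primeCompl) (LocalizedModule q.primeCompl M)) :
    ∃ c : LTSeries (PrimeSpectrum R), c.length = j ∧
      Module.annihilator R M ≤ c.head.asIdeal ∧ c.last.asIdeal ≤ q := by
  obtain ⟨c, hc⟩ := Order.le_krullDim_iff.mp h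
  let A := Localization q.primeCompl
  let K := Module.annihilator A (LocalizedModule q.primeCompl M)
  have hmono : StrictMono (PrimeSpectrum.comap (Ideal.Quotient.mk K)) :=
    Monotone.strictMono_of_injective (fun p q h => Ideal.comap_mono h)
      (PrimeSpectrum.comap_injective_of_surjective _ Ideal.Quotient.mk_surjective)
  have hmono' : StrictMono (PrimeSpectrum.comap (algebraMap R A)) :=
    Monotone.strictMono_of_injective (fun p q h => Ideal.comap_mono h)
      (PrimeSpectrum.localization_comap_injective A q.primeCompl)
  refine ⟨(c.map _ hmono).map _ hmono', hc, ?_, ?_⟩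
  · intro r hr
    change Ideal.Quotient.mk K (algebraMap R A r) ∈ c.head.asIdeal
    rw [Ideal.Quotient.eq_zero_iff_mem.mpr]
    · exact zero_mem _
    · rw [Module.mem_annihilator] at hr ⊢
      intro m
      induction m using LocalizedModule.induction_on with
      | h m s =>
        rw [algebraMap_smul, LocalizedModule.smul'_mk, hr, LocalizedModule.zero_mk]
  · intro r hr
    by_contra hrq
    exact (c.map _ hmono).last.isPrime.ne_top
      (Ideal.eq_top_of_isUnit_mem _ hr (IsLocalization.map_units A (⟨r, hrq⟩ : q.primeCompl)))

lemma le_mDim_of_ltSeries {q : Ideal R} [q.IsPrime] {M : Type*} [AddCommGroup M]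
    [Module R M] (c : LTSeries (PrimeSpectrum R)) (hlast : c.last.asIdeal ≤ q)
    (hhead : Module.annihilator (Localization q.primeCompl) (LocalizedModule q.primeCompl M) ≤
      c.head.asIdeal.map (algebraMap R (Localization q.primeCompl))) :
    (c.length : WithBot ℕ∞) ≤
      mDim (Localization q.primeCompl) (LocalizedModule q.primeCompl M) := by
  let A := Localization q.primeCompl
  let K := Module.annihilator A (LocalizedModule q.primeCompl M)
  have hle : ∀ i, (c i).asIdeal ≤ q := fun i => le_trans (c.monotone (Fin.le_last i)) hlast
  have hdis : ∀ i, Disjoint (q.primeCompl : Set R) ((c i).asIdeal : Set R) := fun i =>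
    Set.disjoint_left.mpr fun x hx hx' => hx (hle i hx')
  have hprime : ∀ i, ((c i).asIdeal.map (algebraMap R A)).IsPrime := fun i =>
    IsLocalization.isPrime_of_isPrime_disjoint q.primeCompl A _ (c i).isPrime (hdis i)
  have hcomap : ∀ i, ((c i).asIdeal.map (algebraMap R A)).comap (algebraMap R A) =
      (c i).asIdeal := fun i =>
    IsLocalization.under_map_of_isPrime_disjoint q.primeCompl A (c i).isPrime (hdis i)
  have hK : ∀ i, K ≤ (c i).asIdeal.map (algebraMap R A) := fun i =>
    hhead.trans (Ideal.map_mono (c.monotone (Fin.zero_le i)))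
  have hcm : ∀ i, (((c i).asIdeal.map (algebraMap R A)).map (Ideal.Quotient.mk K)).comap
      (Ideal.Quotient.mk K) = (c i).asIdeal.map (algebraMap R A) := fun i => by
    rw [Ideal.comap_map_of_surjective _ Ideal.Quotient.mk_surjective, ← RingHom.ker_eq_comap_bot,
      Ideal.mk_ker, sup_eq_left.mpr (hK i)]
  refine Order.le_krullDim_iff.mpr ⟨⟨c.length, fun i =>
    ⟨((c i).asIdeal.map (algebraMap R A)).map (Ideal.Quotient.mk K), ?_⟩, fun i => ?_⟩, rfl⟩
  · have := hprime i
    exact Ideal.map_isPrime_of_surjective Ideal.Quotient.mk_surjective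
      (by rw [Ideal.mk_ker]; exact hK i)
  · have hlt : c i.castSucc < c i.succ := c.step i
    refine lt_of_le_of_ne (Ideal.map_mono (Ideal.map_mono hlt.le)) fun heq => hlt.ne ?_
    have h1 := congrArg (fun p : Ideal (A ⧸ K) =>
      (p.comap (Ideal.Quotient.mk K)).comap (algebraMap R A)) heq
    dsimp only at h1
    rw [hcm, hcm, hcomap, hcomap] at h1
    exact PrimeSpectrum.ext h1

end Localization

section RegularPair

open scoped Pointwise

variable {R : Type*} [CommRing R] {M : Type*} [AddCommGroup M] [Module R M]

lemma isSMulRegular_iff_forall_smul_eq_zero {x : R} :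
    IsSMulRegular M x ↔ ∀ m : M, x • m = 0 → m = 0 :=
  ⟨fun h _ hm => h.right_eq_zero_of_smul hm, IsSMulRegular.of_right_eq_zero_of_smul⟩

lemma isSMulRegular_quotSMulTop_iff {x y : R} :
    IsSMulRegular (QuotSMulTop x M) y ↔ ∀ m m' : M, y • m = x • m' → ∃ m'', m = x • m'' := by
  rw [isSMulRegular_iff_forall_smul_eq_zero, 
    (Submodule.mkQ_surjective (x • (⊤ : Submodule R M))).forall]
  refine forall_congr' fun m => ?_
  rw [← map_smul, Submodule.mkQ_apply, Submodule.mkQ_apply, Submodule.Quotient.mk_eq_zero,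
    Submodule.Quotient.mk_eq_zero, Submodule.mem_smul_pointwise_iff_exists,
    Submodule.mem_smul_pointwise_iff_exists]
  constructor
  · intro h m' hm'
    obtain ⟨m'', -, h''⟩ := h ⟨m', trivial, hm'.symm⟩
    exact ⟨m'', h''.symm⟩
  · rintro h ⟨m', -, hm'⟩
    obtain ⟨m'', h''⟩ := h m' hm'.symm
    exact ⟨m'', trivial, h''.symm⟩

/-- Powers of a regular pair satisfy the conditions defining a regular pair. -/
lemma exists_eq_pow_smul_of_pow_smul_eq {x y : R} (hx : ∀ m : M, x • m = 0 → m = 0)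
    (hxy : ∀ m m' : M, y • m = x • m' → ∃ m'', m = x • m'') (i j : ℕ) (m m' : M)
    (h : y ^ j • m = x ^ i • m') : ∃ m'', m = x ^ i • m'' := by
  have h1 : ∀ (j : ℕ) (m m' : M), y ^ j • m = x • m' → ∃ m'', m = x • m'' := by
    intro j
    induction j with
    | zero => intro m m' h; exact ⟨m', by simpa using h⟩
    | succ j ih =>
      intro m m' h
      rw [pow_succ', mul_smul] at h
      obtain ⟨m1, hm1⟩ := hxy _ _ h
      exact ih _ _ hm1
  induction i generalizing m m' with
  | zero => exact ⟨m, by simp⟩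
  | succ i ih =>
    rw [pow_succ', mul_smul] at h
    obtain ⟨m1, rfl⟩ := h1 j _ _ h
    have h2 : y ^ j • m1 = x ^ i • m' := by
      refine sub_eq_zero.mp (hx _ ?_)
      rw [smul_sub, ← h, smul_comm, sub_self]
    obtain ⟨m2, rfl⟩ := ih _ _ h2
    exact ⟨m2, by rw [pow_succ', mul_smul]⟩

lemma pow_smul_eq_zero_imp {x : R} (hx : ∀ m : M, x • m = 0 → m = 0) (i : ℕ) (m : M)
    (h : x ^ i • m = 0) : m = 0 := by
  induction i with
  | zero => simpa using h
  | succ i ih =>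
    rw [pow_succ', mul_smul] at h
    exact ih (hx _ h)

/-- A case of Hartshorne's connectedness lemma: if a cyclic module over a local ring has a
regular pair inside `α + β`, where `α * β` kills the module, then `α` or `β` kills it. -/
lemma smul_eq_zero_of_regular_pair [IsLocalRing R] {u : M} (hu : ∀ m : M, ∃ a : R, a • u = m)
    {x y : R} (hx : ∀ m : M, x • m = 0 → m = 0)
    (hxy : ∀ m m' : M, y • m = x • m' → ∃ m'', m = x • m'') {α β : Ideal R}
    (hαβ : ∀ a ∈ α, ∀ b ∈ β, (a * b) • u = 0) (hxα : x ∈ α ⊔ β) (hyα : y ∈ α ⊔ β) :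
    (∀ a ∈ α, a • u = 0) ∨ ∀ b ∈ β, b • u = 0 := by
  obtain ⟨a₁, ha₁, b₁, hb₁, rfl⟩ := Submodule.mem_sup.mp hxα
  obtain ⟨a₂, ha₂, b₂, hb₂, rfl⟩ := Submodule.mem_sup.mp hyα
  obtain ⟨m, hm⟩ := hxy (a₁ • u) (a₂ • u) (by
    have h1 := hαβ a₁ ha₁ b₂ hb₂
    have h2 := hαβ a₂ ha₂ b₁ hb₁
    calc (a₂ + b₂) • a₁ • u = (a₁ * a₂) • u + (a₁ * b₂) • u := by module
      _ = (a₁ * a₂) • u + (a₂ * b₁) • u := by rw [h1, h2]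
      _ = (a₁ + b₁) • a₂ • u := by module)
  obtain ⟨c, rfl⟩ := hu m
  have hb : b₁ • u = (a₁ + b₁) • (1 - c) • u := by
    rw [sub_smul, one_smul, smul_sub, ← hm]
    module
  have hc : (c * (1 - c)) • u = 0 := by
    refine hx _ (hx _ ?_)
    calc (a₁ + b₁) • (a₁ + b₁) • (c * (1 - c)) • u
        = ((a₁ + b₁) * c) • (a₁ + b₁) • (1 - c) • u := by module
      _ = b₁ • (a₁ + b₁) • c • u := by rw [← hb]; module
      _ = (a₁ * b₁) • u := by rw [← hm]; module
      _ = 0 := hαβ a₁ ha₁ b₁ hb₁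
  rcases IsLocalRing.isUnit_or_isUnit_one_sub_self c with hunit | hunit
  · right
    intro b hb'
    have h1 : (1 - c) • u = 0 := by
      rw [mul_smul] at hc
      exact hunit.smul_eq_zero.mp hc
    rw [h1, smul_zero] at hb
    refine hx _ ?_
    rw [add_smul, ← mul_smul, hαβ a₁ ha₁ b hb', smul_comm, hb, smul_zero, add_zero]
  · left
    intro a ha'
    have h1 : c • u = 0 := by
      rw [mul_comm, mul_smul] at hc
      exact hunit.smul_eq_zero.mp hc
    rw [h1, smul_zero] at hm
    refine hx _ ?_
    rw [add_smul, smul_comm, hm, smul_zero, zero_add, ← mul_smul, mul_comm, hαβ a ha' b₁ hb₁]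

lemma exists_regular_pair_of_two_le_depthIn {I : Ideal R} (h : 2 ≤ depthIn R I M) :
    ∃ x ∈ I, ∃ y ∈ I, (∀ m : M, x • m = 0 → m = 0) ∧
      ∀ m m' : M, y • m = x • m' → ∃ m'', m = x • m'' := by
  obtain ⟨_, ⟨rs, hrs, hreg, rfl⟩, hlt⟩ :=
    lt_sSup_iff.mp (lt_of_lt_of_le (b := 2) (Nat.cast_lt.mpr one_lt_two) h)
  rcases rs with _ | ⟨x, _ | ⟨y, rs⟩⟩
  · simp at hlt
  · simp at hlt
  · have hw := hreg.toIsWeaklyRegular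
    rw [RingTheory.Sequence.isWeaklyRegular_cons_iff,
      RingTheory.Sequence.isWeaklyRegular_cons_iff] at hw
    exact ⟨x, hrs x (by simp), y, hrs y (by simp),
      isSMulRegular_iff_forall_smul_eq_zero.mp hw.1, isSMulRegular_quotSMulTop_iff.mp hw.2.1⟩

end RegularPair

section Subquotient

variable {R : Type*} [CommRing R]

lemma mem_annihilator_subquot_iff {J J' : Ideal R} {r : R} :
    r ∈ Module.annihilator R (subquot J J') ↔ ∀ f ∈ J', r * f ∈ J := by
  rw [Module.mem_annihilator, (Submodule.mkQ_surjective _).forall, Subtype.forall]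
  refine forall₂_congr fun f hf => ?_
  rw [← map_smul, Submodule.mkQ_apply, Submodule.Quotient.mk_eq_zero]
  rfl

lemma le_annihilator_subquot (J J' : Ideal R) :
    J ≤ Module.annihilator R (subquot J J') := fun _ hr =>
  mem_annihilator_subquot_iff.mpr fun _ _ => J.mul_mem_right _ hr

lemma annihilator_subquot_le {J J' p : Ideal R} [p.IsPrime] (hJ : J ≤ p) (hJ' : ¬ J' ≤ p) :
    Module.annihilator R (subquot J J') ≤ p := by
  intro r hr
  obtain ⟨f, hf, hfp⟩ := Set.not_subset.mp hJ'
  have hrf := hJ (mem_annihilator_subquot_iff.mp hr f hf)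
  exact (Ideal.IsPrime.mem_or_mem ‹_› hrf).resolve_right hfp

/-- The image of `1` in the localization of `⊤ / J`. -/
noncomputable def localizedOne (J q : Ideal R) [q.IsPrime] :
    LocalizedModule q.primeCompl (subquot J (⊤ : Ideal R)) :=
  LocalizedModule.mk (Submodule.mkQ _ ⟨1, Submodule.mem_top⟩) 1

lemma exists_smul_localizedOne_eq (J q : Ideal R) [q.IsPrime]
    (m : LocalizedModule q.primeCompl (subquot J (⊤ : Ideal R))) :
    ∃ a : Localization q.primeCompl, a • localizedOne J q = m := by
  induction m using LocalizedModule.induction_on with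
  | h m s =>
    obtain ⟨⟨f, hf⟩, rfl⟩ := Submodule.mkQ_surjective _ m
    refine ⟨Localization.mk f s, ?_⟩
    rw [localizedOne, LocalizedModule.mk_smul_mk, mul_one, ← map_smul]
    congr 2
    exact Subtype.ext (mul_one f)

lemma algebraMap_smul_localizedOne_eq_zero_iff {J q : Ideal R} [q.IsPrime] {r : R} :
    algebraMap R (Localization q.primeCompl) r • localizedOne J q = 0 ↔
      ∃ t, t ∉ q ∧ t * r ∈ J := by
  rw [algebraMap_smul, localizedOne, LocalizedModule.smul'_mk, ← LocalizedModule.zero_mk 1,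
    LocalizedModule.mk_eq, ← map_smul]
  have key : ∀ t : q.primeCompl, t • (1 : q.primeCompl) •
      Submodule.mkQ (Submodule.comap (Submodule.subtype (⊤ : Ideal R)) J)
        (r • ⟨1, Submodule.mem_top⟩) = t • (1 : q.primeCompl) • 0 ↔ (t : R) * r ∈ J := by
    intro t
    rw [one_smul, one_smul, smul_zero, Submonoid.smul_def, ← map_smul, Submodule.mkQ_apply,
      Submodule.Quotient.mk_eq_zero]
    change (t : R) * (r * 1) ∈ J ↔ _
    rw [mul_one]
  simp only [key]
  exact ⟨fun ⟨t, ht⟩ => ⟨t, t.2, ht⟩, fun ⟨t, htq, ht⟩ => ⟨⟨t, htq⟩, ht⟩⟩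

end Subquotient

section MaximalFaces

variable {k : Type*} [Field k] {V : Type*}

lemma exists_facePrime_le [Fintype V] {Δ : Set (Finset V)} {p : Ideal (MvPolynomial V k)}
    (hp : p.IsPrime) (h : srIdeal k Δ ≤ p) : ∃ F ∈ Δ, facePrime k F ≤ p := by
  classical
  refine ⟨Finset.univ.filter fun v => (X v : MvPolynomial V k) ∉ p, ?_, ?_⟩
  · by_contra hF
    obtain ⟨v, hv, hvp⟩ := Ideal.IsPrime.prod_mem_iff.mp (h (Ideal.subset_span ⟨_, hF, rfl⟩))
    exact (Finset.mem_filter.mp hv).2 hvp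
  · rw [facePrime_eq_span, Ideal.span_le]
    rintro _ ⟨v, hv, rfl⟩
    by_contra hvp
    exact hv (Finset.mem_filter.mpr ⟨Finset.mem_univ v, hvp⟩)

lemma srIdeal_le_facePrime {Δ : Set (Finset V)} (hΔ : IsComplex Δ) {F : Finset V} (hF : F ∈ Δ) :
    srIdeal k Δ ≤ facePrime k F := fun _ hf =>
  mem_facePrime_iff.mpr fun a ha => (mem_srIdeal_iff hΔ).mp hf a (hΔ F hF _ ha)

/-- In a filtration with increasing dimensions, every ideal but the last one is contained in the
prime of each face of maximal size. -/
lemma le_facePrime_of_filtration [Fintype V] {Δ : Set (Finset V)} (hΔ : IsComplex Δ) {d : ℕ}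
    (hd : ∀ F ∈ Δ, F.card ≤ d) {F : Finset V} (hF : F ∈ Δ) (hFd : F.card = d) {t : ℕ}
    {J : ℕ → Ideal (MvPolynomial V k)} (h0 : J 0 = srIdeal k Δ) (hlt : ∀ i < t, J i < J (i + 1))
    (hdim : ∀ i : ℕ, i + 2 ≤ t →
      mDim (MvPolynomial V k) (subquot (J i) (J (i + 1))) <
        mDim (MvPolynomial V k) (subquot (J (i + 1)) (J (i + 2)))) :
    ∀ i < t, J i ≤ facePrime k F := by
  have hsr : ∀ i ≤ t, srIdeal k Δ ≤ J i := by
    intro i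
    induction i with
    | zero => exact fun _ => h0.ge
    | succ i ih => exact fun hi => (ih (by omega)).trans (hlt i (by omega)).le
  intro i
  induction i with
  | zero => exact fun _ => h0.trans_le (srIdeal_le_facePrime hΔ hF)
  | succ i ih =>
    intro hi
    by_contra hcon
    have h1 := card_le_mDim (annihilator_subquot_le (ih (by omega)) hcon)
    have h2 : mDim (MvPolynomial V k) (subquot (J (i + 1)) (J (i + 2))) ≤ d :=
      ringKrullDim_quotient_le fun p hp hle => by
        obtain ⟨G, hG, hGp⟩ := exists_facePrime_le (Δ := Δ) hp
          ((hsr (i + 1) hi.le).trans ((le_annihilator_subquot _ _).trans hle))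
        exact ⟨G, hd G hG, hGp⟩
    rw [hFd] at h1
    exact (h1.trans_lt (hdim i (by omega))).not_ge h2

lemma sup_colon_ne_top {J : Ideal (MvPolynomial V k)} (hJ : IsHomogeneousIdeal k J)
    {E : Finset V} (h : ¬ facePrime k E ≤ J) :
    facePrime k E ⊔ J.colon (facePrime k E : Set (MvPolynomial V k)) ≠ ⊤ := by
  classical
  intro htop
  obtain ⟨p, hp, b, hb, hpb⟩ := Submodule.mem_sup.mp ((Ideal.eq_top_iff_one _).mp htop)
  refine h ?_
  rw [facePrime_eq_span, Ideal.span_le]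
  rintro _ ⟨v, hv, rfl⟩
  have h1 : (1 - p) * X v ∈ J := by
    rw [← hpb, add_sub_cancel_left]
    exact Submodule.mem_colon.mp hb _ (X_mem_facePrime_iff.mpr hv)
  have h2 : homogeneousComponent 1 ((1 - p) * X v) = X v := by
    ext a
    rw [coeff_homogeneousComponent, coeff_mul_X', coeff_X]
    by_cases ha : a = Finsupp.single v 1
    · have h0 : coeff 0 p = 0 := mem_facePrime_iff.mp hp 0 (by simp)
      subst ha
      simp [h0]
    · rw [if_neg (Ne.symm ha)]
      split_ifs with hdeg hva
      · refine absurd ?_ ha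
        have hle : Finsupp.single v 1 ≤ a := by
          rw [Finsupp.single_le_iff]
          exact Nat.one_le_iff_ne_zero.mpr (Finsupp.mem_support_iff.mp hva)
        obtain ⟨b, rfl⟩ := exists_add_of_le hle
        rw [map_add, Finsupp.degree_single] at hdeg
        rw [(Finsupp.degree_eq_zero_iff b).mp (by omega), add_zero]
      · rfl
      · rfl
  have h3 := hJ _ h1 1
  rwa [h2] at h3

end MaximalFaces

section NotSequentially

variable {k : Type*} [Field k] {V : Type*} [Fintype V]

lemma annihilator_le_map_of_le {R : Type*} [CommRing R] {J P q : Ideal R} [q.IsPrime] [P.IsPrime]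
    (hJ : J ≤ P) (hP : P ≤ q) :
    Module.annihilator (Localization q.primeCompl)
      (LocalizedModule q.primeCompl (subquot J (⊤ : Ideal R))) ≤
      P.map (algebraMap R (Localization q.primeCompl)) := by
  intro a ha
  obtain ⟨r, s, rfl⟩ := IsLocalization.exists_mk'_eq q.primeCompl a
  have h1 := Module.mem_annihilator.mp ha (localizedOne J q)
  have h2 : algebraMap R (Localization q.primeCompl) r • localizedOne J q = 0 := by
    rw [← IsLocalization.mk'_spec' (Localization q.primeCompl) r s, mul_smul, h1, smul_zero]
  obtain ⟨t, ht, htr⟩ := algebraMap_smul_localizedOne_eq_zero_iff.mp h2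
  have hr : r ∈ P := (Ideal.IsPrime.mem_or_mem ‹_› (hJ htr)).resolve_left fun h => ht (hP h)
  rw [IsLocalization.mk'_eq_mul_mk'_one]
  exact Ideal.mul_mem_right _ _ (Ideal.mem_map_of_mem _ hr)

lemma smul_localizedOne_eq_zero_of_mem_map {R : Type*} [CommRing R] {J q : Ideal R} [q.IsPrime]
    {a : Localization q.primeCompl} (ha : a ∈ J.map (algebraMap R (Localization q.primeCompl))) :
    a • localizedOne J q = 0 := by
  have h : J.map (algebraMap R (Localization q.primeCompl)) ≤
      LinearMap.ker (LinearMap.toSpanSingleton (Localization q.primeCompl) _ (localizedOne J q)) :=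
    Ideal.map_le_iff_le_comap.mpr fun r hr =>
      algebraMap_smul_localizedOne_eq_zero_iff.mpr
        ⟨1, fun h => ‹q.IsPrime›.ne_top ((Ideal.eq_top_iff_one q).mpr h), by rwa [one_mul]⟩
  exact h ha

/-- Two distinct faces of maximal size obstruct the sequential Serre condition `S_2` as soon as
exchanging a vertex of one of them never gives another face. -/
lemma not_isSeqSerre_two [DecidableEq V] {Δ : Set (Finset V)} (hΔ : IsComplex Δ) {d : ℕ}
    (hd : ∀ F ∈ Δ, F.card ≤ d) {E O : Finset V} (hE : E ∈ Δ) (hEd : E.card = d) (hO : O ∈ Δ)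
    (hOd : O.card = d) (hne : E ≠ O) (hridge : ∀ j, ∀ u ∉ E, insert u (E.erase j) ∉ Δ) :
    ¬ IsSeqSerre k Δ 2 := by
  rintro ⟨t, J, h0, ht, hhom, hlt, hserre, hdim⟩
  obtain ⟨v, hvO, hvE⟩ : ∃ v ∈ O, v ∉ E := by
    by_contra! hcon
    exact hne (Finset.eq_of_subset_of_card_le hcon (hEd.trans hOd.symm).le).symm
  obtain ⟨s, rfl⟩ : ∃ s, t = s + 1 := by
    refine ⟨t - 1, ?_⟩
    rcases Nat.eq_zero_or_pos t with rfl | hpos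
    · exact absurd (top_le_iff.mp ((ht.symm.trans h0).trans_le (srIdeal_le_facePrime hΔ hE)))
        (facePrime_isPrime E).ne_top
    · omega
  have hJE := le_facePrime_of_filtration hΔ hd hE hEd h0 hlt hdim s (by omega)
  have hJO := le_facePrime_of_filtration hΔ hd hO hOd h0 hlt hdim s (by omega)
  have hsr : srIdeal k Δ ≤ J s := by
    have : ∀ i ≤ s, srIdeal k Δ ≤ J i := by
      intro i
      induction i with
      | zero => exact fun _ => h0.ge
      | succ i ih => exact fun hi => (ih (by omega)).trans (hlt i (by omega)).le
    exact this s le_rfl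
  have hhomJ := hhom s (by omega)
  have hserreJ := hserre s (by omega)
  rw [ht] at hserreJ
  generalize J s = K at *
  set P := facePrime k E with hP
  set B := K.colon (P : Set (MvPolynomial V k)) with hB
  have hPK : ¬ P ≤ K := fun h =>
    X_mem_facePrime_iff.mp (hJO (h (X_mem_facePrime_iff.mpr hvE))) hvO
  obtain ⟨𝔪, h𝔪, hle𝔪⟩ := Ideal.exists_le_maximal _ (sup_colon_ne_top hhomJ hPK)
  have := h𝔪.isPrime
  obtain ⟨q, hq, -⟩ := Ideal.exists_minimalPrimes_le hle𝔪
  have hqp : q.IsPrime := hq.1.1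
  have hPq : P ≤ q := le_sup_left.trans hq.1.2
  have hBq : B ≤ q := le_sup_right.trans hq.1.2
  have hprod : ∀ j, (∏ i ∈ E.erase j, X i : MvPolynomial V k) ∈ B := by
    intro j
    have hle : P ≤ K.colon {(∏ i ∈ E.erase j, X i : MvPolynomial V k)} := by
      rw [hP, facePrime_eq_span, Ideal.span_le]
      rintro _ ⟨u, hu, rfl⟩
      refine Submodule.mem_colon_singleton.mpr (hsr (Ideal.subset_span ⟨_, hridge j u hu, ?_⟩))
      rw [Finset.prod_insert fun h => hu (Finset.mem_of_mem_erase h), smul_eq_mul]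
    refine Submodule.mem_colon.mpr fun p hp => ?_
    rw [smul_eq_mul, mul_comm]
    exact Submodule.mem_colon_singleton.mp (hle hp)
  obtain ⟨a, haE, haq⟩ := Ideal.IsPrime.prod_mem_iff.mp (hBq (hprod v))
  obtain ⟨b, hbE, hbq⟩ := Ideal.IsPrime.prod_mem_iff.mp (hBq (hprod a))
  have haE' := Finset.mem_of_mem_erase haE
  let c : LTSeries (PrimeSpectrum (MvPolynomial V k)) := LTSeries.mk 2
    ![⟨P, inferInstance⟩, ⟨facePrime k (E.erase a), inferInstance⟩,
      ⟨facePrime k ((E.erase a).erase b), inferInstance⟩] (by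
    rw [Fin.strictMono_iff_lt_succ]
    intro i
    fin_cases i
    · exact facePrime_lt_of_ssubset (Finset.erase_ssubset haE')
    · exact facePrime_lt_of_ssubset (Finset.erase_ssubset hbE))
  have hlast : c.last.asIdeal ≤ q := by
    change facePrime k ((E.erase a).erase b) ≤ q
    rw [facePrime_eq_span, Ideal.span_le]
    rintro _ ⟨w, hw, rfl⟩
    by_cases hwb : w = b
    · exact hwb ▸ hbq
    · by_cases hwa : w = a
      · exact hwa ▸ haq
      · exact hPq (X_mem_facePrime_iff.mpr fun h => hw (by simp [hwa, hwb, h]))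
  have hdim2 := le_mDim_of_ltSeries (M := subquot K ⊤) c hlast (annihilator_le_map_of_le hJE hPq)
  have hdepth := (le_min le_rfl hdim2).trans (hserreJ q)
  obtain ⟨x, hxq, y, hyq, hx, hxy⟩ :=
    exists_regular_pair_of_two_le_depthIn (WithBot.coe_le_coe.mp hdepth)
  have hrad := IsLocalization.AtPrime.radical_map_of_mem_minimalPrimes
    (Localization q.primeCompl) q _ hq
  rw [← hrad] at hxq hyq
  obtain ⟨i, hi⟩ := hxq
  obtain ⟨j, hj⟩ := hyq
  rw [Ideal.map_sup] at hi hj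
  rcases smul_eq_zero_of_regular_pair (exists_smul_localizedOne_eq K q)
    (pow_smul_eq_zero_imp hx i) (exists_eq_pow_smul_of_pow_smul_eq hx hxy i j)
    (fun p hp b hb => smul_localizedOne_eq_zero_of_mem_map (by
      have hPB : P * B ≤ K := Ideal.mul_le.mpr fun p hp b hb => by
        rw [mul_comm]
        exact Submodule.mem_colon.mp hb p hp
      have := Ideal.mul_mem_mul hp hb
      rw [← Ideal.map_mul] at this
      exact Ideal.map_mono hPB this)) hi hj with hα | hβ
  · have hex : ∀ w : V, ∃ r : MvPolynomial V k, r ∉ q ∧ (w ∉ E → r * X w ∈ K) := by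
      intro w
      by_cases hw : w ∈ E
      · exact ⟨1, fun h => hqp.ne_top ((Ideal.eq_top_iff_one q).mpr h), fun h => absurd hw h⟩
      · obtain ⟨r, hrq, hr⟩ := algebraMap_smul_localizedOne_eq_zero_iff.mp
          (hα _ (Ideal.mem_map_of_mem _ (X_mem_facePrime_iff.mpr hw)))
        exact ⟨r, hrq, fun _ => hr⟩
    choose r hrq hr using hex
    have hrB : ∏ w, r w ∈ B := by
      have hle : P ≤ K.colon {∏ w, r w} := by
        rw [hP, facePrime_eq_span, Ideal.span_le]
        rintro _ ⟨u, hu, rfl⟩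
        refine Submodule.mem_colon_singleton.mpr ?_
        rw [smul_eq_mul, mul_comm, ← Finset.prod_erase_mul _ _ (Finset.mem_univ u), mul_assoc]
        exact K.mul_mem_left _ (hr u hu)
      refine Submodule.mem_colon.mpr fun p hp => ?_
      rw [smul_eq_mul, mul_comm]
      exact Submodule.mem_colon_singleton.mp (hle hp)
    obtain ⟨w, -, hw⟩ := Ideal.IsPrime.prod_mem_iff.mp (hBq hrB)
    exact hrq w hw
  · obtain ⟨r, hrq, hr⟩ := algebraMap_smul_localizedOne_eq_zero_iff.mp
      (hβ _ (Ideal.mem_map_of_mem _ (hprod v)))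
    have hmem := (Ideal.IsPrime.mem_or_mem inferInstance (hJE hr)).resolve_left
      fun h => hrq (hPq h)
    obtain ⟨w, hw, hwP⟩ := Ideal.IsPrime.prod_mem_iff.mp hmem
    exact X_mem_facePrime_iff.mp hwP (Finset.mem_of_mem_erase hw)

end NotSequentially

section EvenCycle

variable {n : ℕ} [NeZero n]

lemma not_isSeqSerre_two_cycleComplex (k : Type*) [Field k] (hn : 3 ≤ n) (heven : Even n) :
    ¬ IsSeqSerre k (cycleComplex n) 2 := by
  obtain ⟨m, hm⟩ := heven
  let parity : ℕ → Finset (Fin n) := fun c => Finset.univ.filter fun v => v.val % 2 = c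
  have hmem : ∀ c v, v ∈ parity c ↔ v.val % 2 = c := by simp [parity]
  have hsucc : ∀ v : Fin n, (v + 1).val % 2 = (v.val + 1) % 2 := by
    intro v
    rw [fin_val_add_one (by omega)]
    split_ifs <;> omega
  have hface : ∀ c, parity c ∈ cycleComplex n := by
    intro c
    rw [mem_cycleComplex (by omega)]
    intro x hx hx'
    rw [hmem] at hx hx'
    rw [hsucc] at hx'
    omega
  have hshift : (parity 1) = (parity 0).map (Equiv.addRight (1 : Fin n)).toEmbedding := by
    ext v
    simp only [Finset.mem_map, Equiv.coe_toEmbedding, Equiv.coe_addRight, hmem]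
    constructor
    · intro hv
      refine ⟨v - 1, ?_, sub_add_cancel v 1⟩
      have := hsucc (v - 1)
      rw [sub_add_cancel] at this
      omega
    · rintro ⟨w, hw, rfl⟩
      rw [hsucc]
      omega
  have hcard : (parity 1).card = (parity 0).card := by rw [hshift, Finset.card_map]
  have hunion : (parity 0).card + (parity 1).card = n := by
    rw [← Finset.card_union_of_disjoint]
    · rw [show parity 0 ∪ parity 1 = Finset.univ by
        ext v
        simp only [Finset.mem_union, hmem, Finset.mem_univ, iff_true]
        omega]
      rw [Finset.card_univ, Fintype.card_fin]
    · rw [Finset.disjoint_left]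
      intro v hv hv'
      rw [hmem] at hv hv'
      omega
  refine not_isSeqSerre_two (d := m) cycleComplex_isComplex (fun F hF => ?_) (hface 0) (by omega)
    (hface 1) (by omega) (fun h => ?_) (fun j u hu h => ?_)
  · have := two_mul_card_le (by omega) hF
    omega
  · have h0 : (0 : Fin n) ∈ parity 0 := by simp [hmem]
    rw [h, hmem] at h0
    simp at h0
  · rw [mem_cycleComplex (by omega)] at h
    rw [hmem] at hu
    have hsub : (u - 1).val % 2 = 0 := by
      have := hsucc (u - 1)
      rw [sub_add_cancel] at this
      omega
    have hadd : (u + 1).val % 2 = 0 := by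
      rw [hsucc]
      omega
    have h1 : j = u - 1 := by
      by_contra hj
      refine h (u - 1) (Finset.mem_insert_of_mem (Finset.mem_erase.mpr
        ⟨Ne.symm hj, (hmem _ _).mpr hsub⟩)) ?_
      rw [sub_add_cancel]
      exact Finset.mem_insert_self _ _
    have h2 : j = u + 1 := by
      by_contra hj
      exact h u (Finset.mem_insert_self _ _) (Finset.mem_insert_of_mem (Finset.mem_erase.mpr
        ⟨Ne.symm hj, (hmem _ _).mpr hadd⟩))
    have h3 : u - 1 + 1 + 1 = u - 1 := by rw [sub_add_cancel, ← h2, h1]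
    have h4 := congrArg Fin.val h3
    rw [fin_val_add_one (by omega), fin_val_add_one (by omega)] at h4
    split_ifs at h4 <;> omega

end EvenCycle

section Depth

variable {R : Type*} [CommRing R]

lemma length_le_depthIn_localized {q : Ideal R} [q.IsPrime] {M : Type*} [AddCommGroup M]
    [Module R M] [Module.Finite R M]
    (hpos : 1 ≤ mDim (Localization q.primeCompl) (LocalizedModule q.primeCompl M)) {rs : List R}
    (hreg : RingTheory.Sequence.IsWeaklyRegular M rs) (hrs : ∀ r ∈ rs, r ∈ q) :
    (rs.length : ℕ∞) ≤ depthIn (Localization q.primeCompl)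
      (q.map (algebraMap R (Localization q.primeCompl))) (LocalizedModule q.primeCompl M) := by
  let A := Localization q.primeCompl
  have hnt : Nontrivial (LocalizedModule q.primeCompl M) := by
    by_contra hcon
    rw [not_nontrivial_iff_subsingleton] at hcon
    rw [mDim, Module.annihilator_eq_top_iff.mpr hcon, ringKrullDim_eq_bot_of_subsingleton] at hpos
    simp at hpos
  have : Module.Finite A (LocalizedModule q.primeCompl M) :=
    Module.Finite.of_isLocalizedModule q.primeCompl (LocalizedModule.mkLinearMap q.primeCompl M)
  have h := hreg.isRegular_of_isLocalizedModule_of_mem A q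
    (LocalizedModule.mkLinearMap q.primeCompl M) hrs
  refine le_sSup ⟨rs.map (algebraMap R A), ?_, h, by rw [List.length_map]⟩
  intro x hx
  obtain ⟨r, hr, rfl⟩ := List.mem_map.mp hx
  exact Ideal.mem_map_of_mem _ (hrs r hr)

lemma isSerreMod_two {M : Type*} [AddCommGroup M] [Module R M] [Module.Finite R M]
    (h1 : ∀ (q : Ideal R) [q.IsPrime],
      1 ≤ mDim (Localization q.primeCompl) (LocalizedModule q.primeCompl M) →
      ∃ x ∈ q, ∀ m : M, x • m = 0 → m = 0)
    (h2 : ∀ (q : Ideal R) [q.IsPrime],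
      2 ≤ mDim (Localization q.primeCompl) (LocalizedModule q.primeCompl M) →
      ∃ x ∈ q, ∃ y ∈ q, (∀ m : M, x • m = 0 → m = 0) ∧
        ∀ m m' : M, y • m = x • m' → ∃ m'', m = x • m'') :
    IsSerreMod 2 R M := by
  intro q _
  by_cases hd2 : 2 ≤ mDim (Localization q.primeCompl) (LocalizedModule q.primeCompl M)
  · obtain ⟨x, hxq, y, hyq, hx, hxy⟩ := h2 q hd2
    have hreg : RingTheory.Sequence.IsWeaklyRegular M [x, y] := by
      rw [RingTheory.Sequence.isWeaklyRegular_cons_iff,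
        RingTheory.Sequence.isWeaklyRegular_singleton_iff]
      exact ⟨isSMulRegular_iff_forall_smul_eq_zero.mpr hx, isSMulRegular_quotSMulTop_iff.mpr hxy⟩
    have hle := length_le_depthIn_localized
      (le_trans (WithBot.coe_le_coe.mpr (Nat.cast_le.mpr one_le_two)) hd2) hreg (by simp [hxq, hyq])
    exact (min_le_left _ _).trans (WithBot.coe_le_coe.mpr hle)
  · by_cases hd1 : 1 ≤ mDim (Localization q.primeCompl) (LocalizedModule q.primeCompl M)
    · obtain ⟨x, hxq, hx⟩ := h1 q hd1
      have hreg : RingTheory.Sequence.IsWeaklyRegular M [x] := by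
        rw [RingTheory.Sequence.isWeaklyRegular_singleton_iff]
        exact isSMulRegular_iff_forall_smul_eq_zero.mpr hx
      have hle := length_le_depthIn_localized hd1 hreg (by simp [hxq])
      refine ((min_le_right _ _).trans ?_).trans (WithBot.coe_le_coe.mpr hle)
      rw [not_le] at hd2
      generalize mDim (Localization q.primeCompl) (LocalizedModule q.primeCompl M) = c at hd2
      cases c with
      | bot => exact bot_le
      | coe c =>
        have hc : c < 2 := WithBot.coe_lt_coe.mp hd2
        rw [← one_add_one_eq_two] at hc
        exact WithBot.coe_le_coe.mpr (Order.le_of_lt_add_one hc)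
    · refine (min_le_right _ _).trans ?_
      rw [not_le] at hd1
      generalize mDim (Localization q.primeCompl) (LocalizedModule q.primeCompl M) = c at hd1
      cases c with
      | bot => exact bot_le
      | coe c =>
        have : c = 0 := Order.lt_one_iff.mp (WithBot.coe_lt_coe.mp hd1)
        rw [this]
        exact WithBot.coe_le_coe.mpr bot_le

end Depth

section Avoidance

variable {k : Type*} [Field k] {V : Type*} [Fintype V]

lemma height_facePrime_sup_span_le (F : Finset V) (T : Finset (MvPolynomial V k))
    (hne : facePrime k F ⊔ Ideal.span (T : Set (MvPolynomial V k)) ≠ ⊤) :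
    (facePrime k F ⊔ Ideal.span (T : Set (MvPolynomial V k))).height ≤
      ((Fintype.card V - F.card + T.card : ℕ) : ℕ∞) := by
  classical
  refine (Ideal.height_le_spanFinrank _ hne).trans (Nat.cast_le.mpr ?_)
  have hspan : facePrime k F ⊔ Ideal.span (T : Set (MvPolynomial V k)) =
      Ideal.span (((Fᶜ.image X ∪ T : Finset (MvPolynomial V k))) : Set (MvPolynomial V k)) := by
    rw [facePrime_eq_span, ← Ideal.span_union]
    congr 1
    ext f
    simp
  rw [hspan]
  refine (Submodule.spanFinrank_span_le_ncard_of_finite (Finset.finite_toSet _)).trans ?_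
  rw [Set.ncard_coe_finset]
  refine (Finset.card_union_le _ _).trans (Nat.add_le_add_right ?_ _)
  exact Finset.card_image_le.trans (Finset.card_compl F).le

lemma height_facePrime_le (F : Finset V) :
    (facePrime k F).height ≤ ((Fintype.card V - F.card : ℕ) : ℕ∞) := by
  have h := height_facePrime_sup_span_le (k := k) F ∅ (by simpa using (facePrime_isPrime F).ne_top)
  simpa using h

lemma exists_mem_notMem_facePrime {c : ℕ} {q : Ideal (MvPolynomial V k)}
    (hq : ((Fintype.card V - c : ℕ) : ℕ∞) < q.height) :
    ∃ x ∈ q, ∀ F : Finset V, c ≤ F.card → x ∉ facePrime k F := by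
  by_contra! hcon
  obtain ⟨F, hF, hle⟩ := (Ideal.subset_union_prime_finite
    (Set.toFinite {F : Finset V | c ≤ F.card}) (f := fun F => facePrime k F) ∅ ∅
    (fun F _ _ _ => facePrime_isPrime F)).mp fun x hx => by
      obtain ⟨F, hF, hxF⟩ := hcon x hx
      exact Set.mem_biUnion hF hxF
  refine hq.not_ge ((Ideal.height_mono hle).trans ((height_facePrime_le F).trans ?_))
  exact Nat.cast_le.mpr (Nat.sub_le_sub_left hF _)

lemma exists_mem_isRelPrime_restrictVars {d : ℕ} {q : Ideal (MvPolynomial V k)}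
    (hq : ((Fintype.card V - d + 1 : ℕ) : ℕ∞) < q.height) {x : MvPolynomial V k}
    (hx : ∀ F : Finset V, F.card = d → x ∉ facePrime k F) :
    ∃ y ∈ q, ∀ F : Finset V, F.card = d →
      IsRelPrime (restrictVars k F x) (restrictVars k F y) := by
  classical
  let primes : Finset (Σ F : Finset V, MvPolynomial F k) :=
    (Finset.univ.filter fun F : Finset V => F.card = d).sigma fun F =>
      (UniqueFactorizationMonoid.factors (restrictVars k F x)).toFinset
  let f : (Σ F : Finset V, MvPolynomial F k) → Ideal (MvPolynomial V k) := fun p =>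
    (Ideal.span {p.2}).comap (restrictVars k p.1)
  have hmem : ∀ p ∈ primes, p.1.card = d ∧ Prime p.2 := by
    intro p hp
    rw [Finset.mem_sigma, Finset.mem_filter, Multiset.mem_toFinset] at hp
    exact ⟨hp.1.2, UniqueFactorizationMonoid.prime_of_factor _ hp.2⟩
  have hprime : ∀ p ∈ primes, (f p).IsPrime := fun p hp => by
    have := (Ideal.span_singleton_prime (hmem p hp).2.ne_zero).mpr (hmem p hp).2
    exact Ideal.IsPrime.comap _
  have hheight : ∀ p ∈ primes, (f p).height ≤ ((Fintype.card V - d + 1 : ℕ) : ℕ∞) := by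
    intro p hp
    obtain ⟨g, hg⟩ := restrictVars_surjective p.1 p.2
    have hf : f p = facePrime k p.1 ⊔ Ideal.span (({g} : Finset (MvPolynomial V k)) :
        Set (MvPolynomial V k)) := by
      have h1 := Ideal.comap_map_of_surjective _ (restrictVars_surjective (k := k) p.1)
        (Ideal.span {g})
      rw [Ideal.map_span, Set.image_singleton, hg] at h1
      have h2 : Ideal.comap (restrictVars k p.1) ⊥ = facePrime k p.1 := ker_restrictVars p.1
      rw [h2, sup_comm] at h1
      rw [Finset.coe_singleton]
      exact h1
    rw [hf]
    have h := height_facePrime_sup_span_le p.1 {g} (hf ▸ (hprime p hp).ne_top)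
    rwa [(hmem p hp).1, Finset.card_singleton] at h
  obtain ⟨y, hyq, hy⟩ : ∃ y ∈ q, ∀ p ∈ primes, y ∉ f p := by
    by_contra! hcon
    obtain ⟨p, hp, hle⟩ := (Ideal.subset_union_prime (s := primes) (f := f) ⟨∅, 0⟩ ⟨∅, 0⟩
      (fun p hp _ _ => hprime p hp)).mp fun y hy => by
        obtain ⟨p, hp, hyp⟩ := hcon y hy
        exact Set.mem_biUnion hp hyp
    exact hq.not_ge ((Ideal.height_mono hle).trans (hheight p hp))
  refine ⟨y, hyq, fun F hF => ?_⟩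
  have hx0 : restrictVars k F x ≠ 0 := fun h => hx F hF (restrictVars_eq_zero_iff.mp h)
  refine WfDvdMonoid.isRelPrime_of_no_irreducible_factors (fun h => hx0 h.1) fun z hz hzx hzy => ?_
  obtain ⟨p, hp, hzp⟩ := UniqueFactorizationMonoid.exists_mem_factors_of_dvd hx0 hz hzx
  refine hy ⟨F, p⟩ ?_ (Ideal.mem_span_singleton.mpr (hzp.dvd'.trans hzy))
  exact Finset.mem_sigma.mpr ⟨Finset.mem_filter.mpr ⟨Finset.mem_univ F, hF⟩,
    Multiset.mem_toFinset.mpr hp⟩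

end Avoidance

section FacetFiltration

variable {k : Type*} [Field k] {V : Type*} {Δ : Set (Finset V)} {e : ℕ}

lemma mem_above_iff {S : Finset V} :
    S ∈ above Δ e ↔ S ∈ above Δ (e + 1) ∨ ∃ F ∈ facetsOfCard Δ (e + 1), S ⊆ F := by
  constructor
  · rintro ⟨T, hT, hST, hc⟩
    by_cases hT' : T ∈ above Δ (e + 1)
    · exact Or.inl (isComplex_above _ _ _ hT' _ hST)
    · rcases (Nat.succ_le_of_lt hc).lt_or_eq with h | h
      · exact absurd ⟨T, hT, subset_rfl, h⟩ hT'
      · exact Or.inr ⟨T, ⟨hT, h.symm, hT'⟩, hST⟩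
  · rintro (h | ⟨F, hF, hSF⟩)
    · exact above_anti Δ e.le_succ h
    · exact ⟨F, hF.1, hSF, by rw [hF.2.1]; exact e.lt_succ_self⟩

lemma mem_srIdeal_above_iff {f : MvPolynomial V k} :
    f ∈ srIdeal k (above Δ e) ↔ f ∈ srIdeal k (above Δ (e + 1)) ∧
      ∀ F ∈ facetsOfCard Δ (e + 1), f ∈ facePrime k F := by
  rw [mem_srIdeal_iff (isComplex_above _ _), mem_srIdeal_iff (isComplex_above _ _)]
  simp only [mem_facePrime_iff, mem_above_iff (e := e)]
  constructor
  · exact fun h => ⟨fun a ha => h a (Or.inl ha), fun F hF a ha => h a (Or.inr ⟨F, hF, ha⟩)⟩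
  · rintro ⟨h1, h2⟩ a (ha | ⟨F, hF, ha⟩)
    · exact h1 a ha
    · exact h2 F hF a ha

lemma not_srIdeal_above_le_facePrime {F : Finset V} {d : ℕ} (hF : F ∈ facetsOfCard Δ d) :
    ¬ srIdeal k (above Δ d) ≤ facePrime k F := by
  intro h
  obtain ⟨v, hv, hvF⟩ := Ideal.IsPrime.prod_mem_iff.mp (h (Ideal.subset_span ⟨F, hF.2.2, rfl⟩))
  exact X_mem_facePrime_iff.mp hvF hv

lemma srIdeal_above_le_facePrime {F : Finset V} (hF : F ∈ facetsOfCard Δ (e + 1)) :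
    srIdeal k (above Δ e) ≤ facePrime k F := fun _ hf => (mem_srIdeal_above_iff.mp hf).2 F hF

lemma srIdeal_above_lt (h : (facetsOfCard Δ (e + 1)).Nonempty) :
    srIdeal k (above Δ e) < srIdeal k (above Δ (e + 1)) := by
  obtain ⟨F, hF⟩ := h
  refine lt_of_le_of_ne (fun f hf => (mem_srIdeal_above_iff.mp hf).1) fun heq => ?_
  exact not_srIdeal_above_le_facePrime hF (heq ▸ srIdeal_above_le_facePrime hF)

lemma exists_facePrime_le_of_annihilator_le [Fintype V] {p : Ideal (MvPolynomial V k)}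
    (hp : p.IsPrime)
    (h : Module.annihilator (MvPolynomial V k)
      (subquot (srIdeal k (above Δ e)) (srIdeal k (above Δ (e + 1)))) ≤ p) :
    ∃ F ∈ facetsOfCard Δ (e + 1), facePrime k F ≤ p := by
  have hfin := Set.toFinite (facetsOfCard Δ (e + 1))
  obtain ⟨F, hF, hle⟩ := (Ideal.IsPrime.inf_le' (s := hfin.toFinset) (f := facePrime k) hp).mp (by
    refine le_trans (fun r hr => mem_annihilator_subquot_iff.mpr fun f hf => ?_) h
    rw [Submodule.mem_finsetInf] at hr
    exact mem_srIdeal_above_iff.mpr ⟨Ideal.mul_mem_left _ _ hf, fun F hF =>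
      Ideal.mul_mem_right _ _ (hr F (hfin.mem_toFinset.mpr hF))⟩)
  exact ⟨F, hfin.mem_toFinset.mp hF, hle⟩

lemma mDim_subquot_above [Fintype V] (h : (facetsOfCard Δ (e + 1)).Nonempty) :
    mDim (MvPolynomial V k) (subquot (srIdeal k (above Δ e)) (srIdeal k (above Δ (e + 1)))) =
      ((e + 1 : ℕ) : WithBot ℕ∞) := by
  refine le_antisymm (ringKrullDim_quotient_le fun p hp hle => ?_) ?_
  · obtain ⟨F, hF, hFp⟩ := exists_facePrime_le_of_annihilator_le hp hle
    exact ⟨F, hF.2.1.le, hFp⟩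
  · obtain ⟨F, hF⟩ := h
    have h1 := card_le_mDim (annihilator_subquot_le (srIdeal_above_le_facePrime (k := k) hF)
      (not_srIdeal_above_le_facePrime hF))
    rwa [hF.2.1] at h1

lemma le_height_of_le_mDim [Fintype V] {q : Ideal (MvPolynomial V k)} [q.IsPrime] {j : ℕ}
    (h : (j : WithBot ℕ∞) ≤ mDim (Localization q.primeCompl) (LocalizedModule q.primeCompl
      (subquot (srIdeal k (above Δ e)) (srIdeal k (above Δ (e + 1)))))) :
    ((Fintype.card V - (e + 1) + j : ℕ) : ℕ∞) ≤ q.height := by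
  obtain ⟨c, rfl, hhead, hlast⟩ := exists_ltSeries_of_le_mDim h
  refine add_length_le_height_of_card_le (fun p hp hle => ?_) c hhead hlast
  obtain ⟨F, hF, hFp⟩ := exists_facePrime_le_of_annihilator_le hp hle
  exact ⟨F, hF.2.1.le, hFp⟩

lemma subquot_eq_zero_of_smul_eq_zero {x : MvPolynomial V k}
    (hx : ∀ F ∈ facetsOfCard Δ (e + 1), x ∉ facePrime k F)
    (m : subquot (srIdeal k (above Δ e)) (srIdeal k (above Δ (e + 1)))) (h : x • m = 0) :
    m = 0 := by
  obtain ⟨⟨f, hf⟩, rfl⟩ := Submodule.mkQ_surjective _ m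
  rw [← map_smul, Submodule.mkQ_apply, Submodule.Quotient.mk_eq_zero] at h
  rw [Submodule.mkQ_apply, Submodule.Quotient.mk_eq_zero]
  have h' : x * f ∈ srIdeal k (above Δ e) := h
  exact mem_srIdeal_above_iff.mpr ⟨hf, fun F hF => (Ideal.IsPrime.mem_or_mem inferInstance
    ((mem_srIdeal_above_iff.mp h').2 F hF)).resolve_left (hx F hF)⟩

/-- Polynomials on the facets of a given size whose coefficients agree on common faces, and vanish
on larger faces, are the restrictions of one polynomial. -/
lemma exists_glued [Fintype V] {d : ℕ} (h : Finset V → MvPolynomial V k)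
    (hagree : ∀ a : V →₀ ℕ, ∀ F ∈ facetsOfCard Δ d, ∀ F' ∈ facetsOfCard Δ d,
      a.support ⊆ F → a.support ⊆ F' → coeff a (h F) = coeff a (h F'))
    (hzero : ∀ a : V →₀ ℕ, a.support ∈ above Δ d → ∀ F ∈ facetsOfCard Δ d, a.support ⊆ F →
      coeff a (h F) = 0) :
    ∃ g ∈ srIdeal k (above Δ d), ∀ F ∈ facetsOfCard Δ d, g - h F ∈ facePrime k F := by
  classical
  let φ : (V →₀ ℕ) → k := fun a =>
    if ha : ∃ F ∈ facetsOfCard Δ d, a.support ⊆ F then coeff a (h ha.choose) else 0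
  let T : Finset (V →₀ ℕ) := Finset.univ.biUnion fun F => (h F).support
  have hcoeff : ∀ a, coeff a (∑ b ∈ T, monomial b (φ b)) = φ a := by
    intro a
    rw [coeff_sum]
    simp only [coeff_monomial, Finset.sum_ite_eq']
    refine ite_eq_left_iff.mpr fun haT => ?_
    dsimp only [φ]
    split_ifs with ha
    · by_contra hne
      exact haT (Finset.mem_biUnion.mpr ⟨_, Finset.mem_univ _, mem_support_iff.mpr (Ne.symm hne)⟩)
    · rfl
  refine ⟨∑ b ∈ T, monomial b (φ b), ?_, fun F hF => mem_facePrime_iff.mpr fun a ha => ?_⟩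
  · rw [mem_srIdeal_iff (isComplex_above _ _)]
    intro a ha
    rw [hcoeff]
    dsimp only [φ]
    split_ifs with hex
    · exact hzero a ha _ hex.choose_spec.1 hex.choose_spec.2
    · rfl
  · rw [coeff_sub, hcoeff, sub_eq_zero]
    have hex : ∃ F ∈ facetsOfCard Δ d, a.support ⊆ F := ⟨F, hF, ha⟩
    dsimp only [φ]
    rw [dif_pos hex]
    exact hagree a _ hex.choose_spec.1 _ hF hex.choose_spec.2 ha

lemma exists_subquot_eq_smul [Fintype V] (hglue : Glues k Δ (e + 1)) {x y : MvPolynomial V k}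
    (hx : ∀ G : Finset V, e ≤ G.card → x ∉ facePrime k G)
    (hxy : ∀ F : Finset V, F.card = e + 1 → IsRelPrime (restrictVars k F x) (restrictVars k F y))
    (m m' : subquot (srIdeal k (above Δ e)) (srIdeal k (above Δ (e + 1))))
    (h : y • m = x • m') : ∃ m'', m = x • m'' := by
  obtain ⟨⟨f, hf⟩, rfl⟩ := Submodule.mkQ_surjective _ m
  obtain ⟨⟨g, hg⟩, rfl⟩ := Submodule.mkQ_surjective _ m'
  rw [← sub_eq_zero, ← map_smul, ← map_smul, ← map_sub, Submodule.mkQ_apply,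
    Submodule.Quotient.mk_eq_zero] at h
  have hfg : y * f - x * g ∈ srIdeal k (above Δ e) := h
  have hlocal : ∀ F : Finset V, ∃ p : MvPolynomial V k, F ∈ facetsOfCard Δ (e + 1) →
      f - x * p ∈ facePrime k F := by
    intro F
    by_cases hF : F ∈ facetsOfCard Δ (e + 1)
    · have h1 := restrictVars_eq_zero_iff.mpr (srIdeal_above_le_facePrime hF hfg)
      rw [map_sub, map_mul, map_mul, sub_eq_zero] at h1
      obtain ⟨p, hp⟩ := (hxy F hF.2.1).dvd_of_dvd_mul_left (Dvd.intro _ h1.symm)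
      obtain ⟨p, rfl⟩ := restrictVars_surjective F p
      refine ⟨p, fun _ => restrictVars_eq_zero_iff.mp ?_⟩
      rw [map_sub, map_mul, hp, sub_self]
    · exact ⟨0, fun h => absurd h hF⟩
  choose p hp using hlocal
  have hcompat : ∀ a : V →₀ ℕ,
      RidgeCompatible Δ (e + 1) a.support fun F => coeff a (p F) := by
    intro a
    refine ⟨fun F hF F' hF' G hGF hGF' hSG hG => ?_, fun F hF G hGa hGF hSG hG => ?_⟩
    · have h1 : x * (p F - p F') ∈ facePrime k G := by
        have h2 := facePrime_anti hGF (hp F hF)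
        have h3 := facePrime_anti hGF' (hp F' hF')
        have h4 := Ideal.sub_mem _ h3 h2
        rwa [show f - x * p F' - (f - x * p F) = x * (p F - p F') by ring] at h4
      have h5 := (Ideal.IsPrime.mem_or_mem inferInstance h1).resolve_left (hx G (by omega))
      have h6 := mem_facePrime_iff.mp h5 a hSG
      rwa [coeff_sub, sub_eq_zero] at h6
    · have h1 : f ∈ facePrime k G := srIdeal_le_facePrime (isComplex_above _ _) hGa hf
      have h2 := Ideal.sub_mem _ h1 (facePrime_anti hGF (hp F hF))
      rw [sub_sub_cancel] at h2
      have h3 := (Ideal.IsPrime.mem_or_mem inferInstance h2).resolve_left (hx G (by omega))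
      exact mem_facePrime_iff.mp h3 a hSG
  obtain ⟨q, hq, hqF⟩ := exists_glued (Δ := Δ) (d := e + 1) p
    (fun a F hF F' hF' haF haF' => by
      by_cases ha : a.support ∈ above Δ (e + 1)
      · exact ((hglue _ _ (hcompat a)).2 ha F hF haF).trans
          ((hglue _ _ (hcompat a)).2 ha F' hF' haF').symm
      · exact (hglue _ _ (hcompat a)).1 ha F hF F' hF' haF haF')
    (fun a ha F hF haF => (hglue _ _ (hcompat a)).2 ha F hF haF)
  refine ⟨Submodule.mkQ _ ⟨q, hq⟩, ?_⟩
  rw [← sub_eq_zero, ← map_smul, ← map_sub, Submodule.mkQ_apply, Submodule.Quotient.mk_eq_zero]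
  change f - x * q ∈ srIdeal k (above Δ e)
  refine mem_srIdeal_above_iff.mpr ⟨Ideal.sub_mem _ hf (Ideal.mul_mem_left _ _ hq), fun F hF => ?_⟩
  have h1 := Ideal.sub_mem _ (hp F hF) (Ideal.mul_mem_left _ x (hqF F hF))
  rwa [show f - x * p F - x * (q - p F) = f - x * q by ring] at h1

lemma isSerreMod_two_subquot_above [Fintype V] (hglue : Glues k Δ (e + 1)) :
    IsSerreMod 2 (MvPolynomial V k)
      (subquot (srIdeal k (above Δ e)) (srIdeal k (above Δ (e + 1)))) := by
  refine isSerreMod_two (fun q _ h1 => ?_) (fun q _ h2 => ?_)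
  · have hq := le_height_of_le_mDim (j := 1) h1
    obtain ⟨x, hxq, hx⟩ := exists_mem_notMem_facePrime (c := e + 1)
      (lt_of_lt_of_le (Nat.cast_lt.mpr (Nat.lt_succ_self _)) hq)
    exact ⟨x, hxq, subquot_eq_zero_of_smul_eq_zero fun F hF => hx F hF.2.1.ge⟩
  · have hq := le_height_of_le_mDim (j := 2) h2
    have hq' : ((Fintype.card V - (e + 1) + 1 : ℕ) : ℕ∞) < q.height :=
      lt_of_lt_of_le (Nat.cast_lt.mpr (Nat.lt_succ_self _)) hq
    obtain ⟨x, hxq, hx⟩ := exists_mem_notMem_facePrime (c := e)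
      (lt_of_le_of_lt (Nat.cast_le.mpr (by omega)) hq')
    obtain ⟨y, hyq, hxy⟩ := exists_mem_isRelPrime_restrictVars hq' fun F hF => hx F (by omega)
    exact ⟨x, hxq, y, hyq, subquot_eq_zero_of_smul_eq_zero fun F hF => hx F (by rw [hF.2.1]; omega),
      exists_subquot_eq_smul hglue hx hxy⟩

end FacetFiltration

/-- The odd cycle is sequentially `S_2`, through the filtration by sizes of facets. -/
lemma isSeqSerre_two_cycleComplex (k : Type*) [Field k] {n : ℕ} [NeZero n] (hn : 3 ≤ n)
    (hodd : Odd n) : IsSeqSerre k (cycleComplex n) 2 := by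
  obtain ⟨m, hm⟩ := hodd
  obtain ⟨e, he⟩ : ∃ e, e = (n - 1) / 3 := ⟨_, rfl⟩
  have hfacets : ∀ i < m - e, (facetsOfCard (cycleComplex n) (e + i + 1)).Nonempty :=
    fun i hi => exists_facetOfCard hn (by omega) (by omega)
  refine ⟨m - e, fun i => srIdeal k (above (cycleComplex n) (e + i)), ?_, ?_, ?_, ?_, ?_, ?_⟩
  · exact congrArg (srIdeal k) (above_cycleComplex_of_lt (by omega) (by omega))
  · refine (Ideal.eq_top_iff_one _).mpr (Ideal.subset_span ⟨∅, ?_, Finset.prod_empty.symm⟩)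
    rintro ⟨T, hT, -, hlt⟩
    have := two_mul_card_le (by omega) hT
    omega
  · exact fun i _ => isHomogeneousIdeal_srIdeal (isComplex_above _ _)
  · exact fun i hi => srIdeal_above_lt (hfacets i hi)
  · exact fun i _ => isSerreMod_two_subquot_above
      (glues_cycleComplex ⟨m, hm⟩ (by omega) k (Nat.succ_pos _))
  · intro i hi
    have h1 := mDim_subquot_above (k := k) (hfacets i (by omega))
    have h2 := mDim_subquot_above (k := k) (hfacets (i + 1) (by omega))
    exact h1.trans_lt (lt_of_lt_of_eq (Nat.cast_lt.mpr (by omega)) h2.symm)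

/-- **Sequentially `S_2` cycles.**
Let `n ≥ 3` and let `C_n` be the cycle graph on `n` vertices.  Then `C_n` is
sequentially `S_2` over a field `k` if and only if `n` is odd. -/
theorem cycleGraph_isSeqSerre_two_iff_odd (k : Type*) [Field k] (n : ℕ)
    (hn : 3 ≤ n) :
    IsSeqSerre k (indepComplex (SimpleGraph.cycleGraph n)) 2 ↔ Odd n := by
  have : NeZero n := ⟨by omega⟩
  refine ⟨fun h => ?_, isSeqSerre_two_cycleComplex k hn⟩
  by_contra hodd
  exact not_isSeqSerre_two_cycleComplex k hn (Nat.not_odd_iff_even.mp hodd) h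

end SeqSr
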